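/- Let N ≥ 1, m ≥ 1 and p > N with p ≥ 2, and let f ∈ X_T and g ∈ X_T be the mild solutions of the Fermi-Dirac-Fokker-Planck equation on [0,T] with respective initial data f₀ ∈ Υ and g₀ ∈ Υ. If f₀ ≤ g₀ a.e. on ℝ^N, then for every t ∈ (0,T], f(t,v) ≤ g(t,v) for a.e. v ∈ ℝ^N. -/

import Mathlib

open MeasureTheory Real Filter
open scoped ENNReal NNReal Topology

noncomputable section


/-- ℝ^N as a Euclidean space. -/
abbrev Evec (N : ℕ) := EuclideanSpace ℝ (Fin N)

/-- The weighted norm `‖(1+|v|^m) f‖_{L^p(ℝ^N)}` (as an extended nonnegative real). -/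
noncomputable def wLpNorm (N : ℕ) (p : ℝ≥0∞) (m : ℝ) (f : Evec N → ℝ) : ℝ≥0∞ :=
  eLpNorm (fun v => (1 + ‖v‖ ^ m) * f v) p volume

/-- The weighted norm `‖(1+|v|^m) G‖_{L^p(ℝ^N)}` of a vector field `G`. -/
noncomputable def wLpNormV (N : ℕ) (p : ℝ≥0∞) (m : ℝ) (G : Evec N → Evec N) : ℝ≥0∞ :=
  eLpNorm (fun v => (1 + ‖v‖ ^ m) * ‖G v‖) p volume

/-- Membership in `Υ = L^∞ ∩ L¹₁ ∩ L^p_m`. -/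
def MemUpsilon (N : ℕ) (p m : ℝ) (f : Evec N → ℝ) : Prop :=
  AEStronglyMeasurable f volume ∧ eLpNorm f ⊤ volume < ⊤ ∧
    wLpNorm N 1 1 f < ⊤ ∧ wLpNorm N (ENNReal.ofReal p) m f < ⊤

/-- The norm of `Υ`: `max {‖f‖_∞, ‖f‖_{L¹₁}, ‖f‖_{L^p_m}}`. -/
noncomputable def UpsilonNorm (N : ℕ) (p m : ℝ) (f : Evec N → ℝ) : ℝ≥0∞ :=
  max (eLpNorm f ⊤ volume) (max (wLpNorm N 1 1 f) (wLpNorm N (ENNReal.ofReal p) m f))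

/-- The fundamental solution `𝓕(t,v,w)` of the linear Fokker-Planck equation
`∂_t f = Δ_v f + div_v(vf)`. -/
noncomputable def FPkernel (N : ℕ) (t : ℝ) (v w : Evec N) : ℝ :=
  exp ((N : ℝ) * t) * (2 * π * (exp (2 * t) - 1)) ^ (-(N : ℝ) / 2) *
    exp (-‖exp t • v - w‖ ^ 2 / (2 * (exp (2 * t) - 1)))

/-- Continuity of `t ↦ f(t)` from `[0,T]` into `Υ` (w.r.t. the `Υ` norm). -/
def ContinuousInUpsilon (N : ℕ) (p m T : ℝ) (f : ℝ → Evec N → ℝ) : Prop :=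
  ∀ t₀ ∈ Set.Icc (0 : ℝ) T, ∀ ε : ℝ, 0 < ε → ∃ δ : ℝ, 0 < δ ∧
    ∀ t ∈ Set.Icc (0 : ℝ) T, |t - t₀| < δ →
      UpsilonNorm N p m (fun v => f t v - f t₀ v) < ENNReal.ofReal ε

/-- A mild solution on `[0,T]` of the Fermi-Dirac-Fokker-Planck equation
`∂_t f = Δ_v f + div_v(v f (1-f))` with initial datum `f₀`:
a function `f ∈ C([0,T]; Υ)` with `f(0) = f₀` satisfying the Duhamel formula
`f(t,v) = ∫ 𝓕(t,v,w) f₀(w) dw + ∫₀ᵗ e^{-(t-s)} ∫ (∇_v𝓕(t-s,v,w)·w) f(s,w)² dw ds`. -/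
def IsMildSolution (N : ℕ) (p m T : ℝ) (f₀ : Evec N → ℝ) (f : ℝ → Evec N → ℝ) : Prop :=
  (∀ t ∈ Set.Icc (0 : ℝ) T, MemUpsilon N p m (f t)) ∧
  ContinuousInUpsilon N p m T f ∧
  f 0 =ᵐ[volume] f₀ ∧
  ∀ t ∈ Set.Ioc (0 : ℝ) T, ∀ᵐ v : Evec N ∂volume,
    f t v = (∫ w : Evec N, FPkernel N t v w * f₀ w) +
      ∫ s in Set.Ioc (0 : ℝ) t, exp (-(t - s)) *
        ∫ w : Evec N,
          (@inner ℝ _ _ (gradient (fun u => FPkernel N (t - s) u w) v) w) * (f s w) ^ 2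

/-- Membership in `X_T`: a mild solution on `[0,T]` with
`sup_{0<t<T} ν(t)^{1/2} (‖∇_v f(t)‖_{L^p_m} + ‖∇_v f(t)‖_{L¹₁}) < ∞`, `ν(t) = e^{2t}-1`. -/
def MemXT (N : ℕ) (p m T : ℝ) (f₀ : Evec N → ℝ) (f : ℝ → Evec N → ℝ) : Prop :=
  IsMildSolution N p m T f₀ f ∧
  ∃ C : ℝ≥0∞, C ≠ ⊤ ∧ ∀ t ∈ Set.Ioo (0 : ℝ) T,
    ENNReal.ofReal (Real.sqrt (exp (2 * t) - 1)) *
      (wLpNormV N (ENNReal.ofReal p) m (fun v => gradient (f t) v) +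
        wLpNormV N 1 1 (fun v => gradient (f t) v)) ≤ C

/-- A global mild solution: the restriction to `[0,T]` belongs to `X_T` for every `T > 0`. -/
def IsGlobalSolution (N : ℕ) (p m : ℝ) (f₀ : Evec N → ℝ) (f : ℝ → Evec N → ℝ) : Prop :=
  ∀ T : ℝ, 0 < T → MemXT N p m T f₀ f


section
open scoped ContDiff

/-- Standard Gaussian density. -/
def ga (N : ℕ) (z : Evec N) : ℝ := (2 * π) ^ (-(N : ℝ) / 2) * exp (-(1/2) * ‖z‖ ^ 2)

def aa (t : ℝ) : ℝ := exp (-t) * √(exp (2 * t) - 1)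

lemma aa_cont : Continuous aa := by unfold aa; fun_prop

lemma nu_pos {t : ℝ} (ht : 0 < t) : 0 < exp (2 * t) - 1 := by
  have := Real.add_one_lt_exp (x := 2 * t) (by positivity)
  linarith

lemma aa_pos {t : ℝ} (ht : 0 < t) : 0 < aa t :=
  mul_pos (exp_pos _) (Real.sqrt_pos.2 (nu_pos ht))

lemma aa_sq {t : ℝ} (ht : 0 ≤ t) : aa t ^ 2 = 1 - exp (-2 * t) := by
  unfold aa
  have h : 0 ≤ exp (2 * t) - 1 := by
    have := Real.add_one_le_exp (2 * t)
    linarith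
  rw [mul_pow, Real.sq_sqrt h, ← Real.exp_nat_mul, mul_sub, ← Real.exp_add]
  congr 1
  · rw [Real.exp_eq_one_iff]; push_cast; ring
  · push_cast; ring_nf

lemma aa_zero : aa 0 = 0 := by simp [aa]

lemma aa_le {t : ℝ} (ht : 0 ≤ t) : |aa t| ≤ 1 := by
  rw [← sq_le_one_iff_abs_le_one, aa_sq ht]
  have := exp_pos (-2 * t)
  linarith

lemma ga_nonneg (N : ℕ) (z : Evec N) : 0 ≤ ga N z := by unfold ga; positivity

lemma ga_contDiff (N : ℕ) : ContDiff ℝ ∞ (ga N) := by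
  unfold ga
  exact contDiff_const.mul ((contDiff_const.mul (contDiff_norm_sq ℝ)).exp)

lemma ga_cont (N : ℕ) : Continuous (ga N) := (ga_contDiff N).continuous

lemma gauss_int {N : ℕ} {b : ℝ} (hb : 0 < b) :
    Integrable (fun z : Evec N => exp (-b * ‖z‖ ^ 2)) := by
  apply Integrable.of_integral_ne_zero
  rw [GaussianFourier.integral_rexp_neg_mul_sq_norm hb]
  positivity

lemma ga_int (N : ℕ) : Integrable (ga N) := (gauss_int (by norm_num)).const_mul _

lemma ga_one (N : ℕ) : ∫ z, ga N z = 1 := by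
  unfold ga
  rw [integral_const_mul, GaussianFourier.integral_rexp_neg_mul_sq_norm (by norm_num)]
  simp only [finrank_euclideanSpace, Fintype.card_fin]
  rw [show π / (1/2) = 2 * π by ring, ← Real.rpow_add (by positivity)]
  rw [show -(N : ℝ) / 2 + N / 2 = 0 by ring, Real.rpow_zero]

lemma ga_norm_int (N : ℕ) : Integrable (fun z => ga N z * ‖z‖) := by
  have h := (gauss_int (N := N) (b := 1/4) (by norm_num)).const_mul (2 * (2 * π) ^ (-(N : ℝ) / 2))
  refine h.mono' ((ga_cont N).mul continuous_norm).aestronglyMeasurable (ae_of_all _ fun z => ?_)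
  rw [norm_mul, norm_norm, Real.norm_of_nonneg (ga_nonneg N z)]
  unfold ga
  have h1 : ‖z‖ ≤ 2 * exp (1/4 * ‖z‖ ^ 2) := by
    have := Real.add_one_le_exp (1/4 * ‖z‖ ^ 2)
    nlinarith [sq_nonneg (‖z‖ - 2)]
  have h2 : exp (-(1/2) * ‖z‖^2) * exp (1/4 * ‖z‖ ^ 2) = exp (-(1/4) * ‖z‖ ^ 2) := by
    rw [← Real.exp_add]; ring_nf
  calc (2 * π) ^ (-(N : ℝ) / 2) * exp (-(1/2) * ‖z‖ ^ 2) * ‖z‖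
      ≤ (2 * π) ^ (-(N : ℝ) / 2) * exp (-(1/2) * ‖z‖ ^ 2) * (2 * exp (1/4 * ‖z‖ ^ 2)) := by gcongr
    _ = 2 * (2 * π) ^ (-(N : ℝ) / 2) * (exp (-(1/2) * ‖z‖^2) * exp (1/4 * ‖z‖ ^ 2)) := by ring
    _ = _ := by rw [h2]

lemma FP_point {N : ℕ} {t : ℝ} (ht : 0 < t) (w z : Evec N) :
    FPkernel N t (exp (-t) • w + aa t • z) w = (aa t ^ N)⁻¹ * ga N z := by
  have hn := nu_pos ht
  have h1 : exp t • (exp (-t) • w + aa t • z) - w = √(exp (2 * t) - 1) • z := by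
    rw [smul_add, smul_smul, smul_smul, ← Real.exp_add]
    unfold aa
    rw [← mul_assoc, ← Real.exp_add]
    simp
  unfold FPkernel ga
  rw [h1, norm_smul, mul_pow, Real.norm_of_nonneg (Real.sqrt_nonneg _), Real.sq_sqrt hn.le]
  have h2 : -((exp (2 * t) - 1) * ‖z‖ ^ 2) / (2 * (exp (2 * t) - 1)) = -(1/2) * ‖z‖ ^ 2 := by
    field_simp
  rw [h2, ← mul_assoc]
  congr 1
  unfold aa
  rw [mul_pow, mul_inv, ← Real.exp_nat_mul, ← Real.exp_neg,
    Real.mul_rpow (by positivity) hn.le]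
  have h3 : (√(exp (2 * t) - 1) ^ N)⁻¹ = (exp (2 * t) - 1) ^ (-(N : ℝ) / 2) := by
    rw [Real.sqrt_eq_rpow, ← Real.rpow_natCast, ← Real.rpow_mul hn.le, ← Real.rpow_neg hn.le]
    congr 1; ring
  rw [h3]
  ring_nf

lemma FP_subst {N : ℕ} {t : ℝ} (ht : 0 < t) (w : Evec N) (g : Evec N → ℝ) :
    ∫ v, FPkernel N t v w * g v = ∫ z, ga N z * g (exp (-t) • w + aa t • z) := by
  have ha := aa_pos ht
  have h1 := Measure.integral_comp_smul (volume : Measure (Evec N))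
    (fun x => FPkernel N t (exp (-t) • w + x) w * g (exp (-t) • w + x)) (aa t)
  simp only [FP_point ht] at h1
  rw [integral_add_left_eq_self (fun x => FPkernel N t x w * g x) (exp (-t) • w)] at h1
  simp only [finrank_euclideanSpace, Fintype.card_fin, smul_eq_mul, mul_assoc] at h1
  rw [integral_const_mul, abs_of_pos (by positivity)] at h1
  exact (mul_left_cancel₀ (by positivity) h1).symm

lemma FP_subst_int {N : ℕ} {t : ℝ} (ht : 0 < t) (w : Evec N) (g : Evec N → ℝ) :
    Integrable (fun v => FPkernel N t v w * g v) ↔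
      Integrable (fun z => ga N z * g (exp (-t) • w + aa t • z)) := by
  have ha := aa_pos ht
  have h1 := integrable_comp_smul_iff (volume : Measure (Evec N))
    (fun x => FPkernel N t (exp (-t) • w + x) w * g (exp (-t) • w + x)) ha.ne'
  simp only [FP_point ht] at h1
  have h2 : Integrable (fun x => FPkernel N t (exp (-t) • w + x) w * g (exp (-t) • w + x)) ↔
      Integrable (fun v => FPkernel N t v w * g v) :=
    (measurePreserving_add_left volume (exp (-t) • w)).integrable_comp_emb
      (measurableEmbedding_addLeft _) (g := fun x => FPkernel N t x w * g x)
  rw [← h2, ← h1]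
  simp only [mul_assoc]
  exact integrable_const_mul_iff (by simp [ha.ne']) _

abbrev ee {N : ℕ} (i : Fin N) : Evec N := EuclideanSpace.single i (1 : ℝ)

def DD {N : ℕ} (u : Evec N) (ψ : Evec N → ℝ) : Evec N → ℝ := fun v => fderiv ℝ ψ v u

def Lap {N : ℕ} (ψ : Evec N → ℝ) : Evec N → ℝ := fun v => ∑ i, DD (ee i) (DD (ee i) ψ) v

def LL {N : ℕ} (ψ : Evec N → ℝ) : Evec N → ℝ := fun v => Lap ψ v - fderiv ℝ ψ v v

def PP {N : ℕ} (t : ℝ) (ψ : Evec N → ℝ) (w : Evec N) : ℝ :=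
  ∫ z, ga N z * ψ (exp (-t) • w + aa t • z)

def QQ {N : ℕ} (t : ℝ) (ψ : Evec N → ℝ) (w : Evec N) : ℝ := exp (-t) * PP t (DD w ψ) w

/-- smooth compactly supported -/
def Tst {N : ℕ} (ψ : Evec N → ℝ) : Prop := ContDiff ℝ ∞ ψ ∧ HasCompactSupport ψ

section
variable {N : ℕ} {ψ : Evec N → ℝ}

lemma vec_sum (w : Evec N) : w = ∑ i, w i • ee i := by
  ext j
  simp [ee, Finset.sum_apply, Pi.single_apply]

lemma fderiv_sum_ee (v w : Evec N) : fderiv ℝ ψ v w = ∑ i, w i * DD (ee i) ψ v := by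
  conv_lhs => rw [vec_sum w]
  rw [map_sum]
  simp [DD]

lemma Tst.cont (h : Tst ψ) : Continuous ψ := h.1.continuous

lemma Tst.diff (h : Tst ψ) : Differentiable ℝ ψ := h.1.differentiable (by simp)

lemma ContDiff.dd (h : ContDiff ℝ ∞ ψ) (u : Evec N) : ContDiff ℝ ∞ (DD u ψ) :=
  (h.fderiv_right (m := ∞) (by simp)).clm_apply contDiff_const

lemma Tst.dd (h : Tst ψ) (u : Evec N) : Tst (DD u ψ) := ⟨h.1.dd u, h.2.fderiv_apply ℝ u⟩

lemma Tst.add {χ : Evec N → ℝ} (h : Tst ψ) (h' : Tst χ) : Tst (fun v => ψ v + χ v) :=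
  ⟨h.1.add h'.1, h.2.add h'.2⟩

lemma Tst.sub {χ : Evec N → ℝ} (h : Tst ψ) (h' : Tst χ) : Tst (fun v => ψ v - χ v) :=
  ⟨h.1.sub h'.1, h.2.sub h'.2⟩

lemma Tst.zero : Tst (fun _ : Evec N => (0:ℝ)) := ⟨contDiff_const, HasCompactSupport.zero⟩

lemma Tst.sum {ι : Type*} (s : Finset ι) {χ : ι → Evec N → ℝ} (h : ∀ i, Tst (χ i)) :
    Tst (fun v => ∑ i ∈ s, χ i v) := by
  classical
  induction s using Finset.induction_on with
  | empty => simpa using Tst.zero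
  | insert i s hi ih => simp only [Finset.sum_insert hi]; exact (h i).add ih

lemma Tst.mul {χ : Evec N → ℝ} (h : Tst ψ) (h' : ContDiff ℝ ∞ χ) : Tst (fun v => ψ v * χ v) :=
  ⟨h.1.mul h', h.2.mul_right⟩

lemma Tst.lap (h : Tst ψ) : Tst (Lap ψ) := Tst.sum _ fun _ => (h.dd _).dd _

lemma Tst.euler (h : Tst ψ) : Tst (fun v => fderiv ℝ ψ v v) := by
  refine ⟨(h.1.fderiv_right (m := ∞) (by simp)).clm_apply contDiff_id, ?_⟩
  refine (h.2.fderiv ℝ).mono fun v hv => ?_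
  contrapose! hv
  simp only [Function.mem_support, not_not] at hv ⊢
  rw [hv]; rfl

lemma Tst.ll (h : Tst ψ) : Tst (LL ψ) := h.lap.sub h.euler

lemma Tst.bdd (h : Tst ψ) : ∃ C, 0 ≤ C ∧ ∀ v, |ψ v| ≤ C := by
  obtain ⟨C, hC⟩ := h.2.exists_bound_of_continuous h.cont
  exact ⟨C, (norm_nonneg _).trans (hC 0), hC⟩

lemma Tst.bdd' (h : Tst ψ) : ∃ C, 0 ≤ C ∧ ∀ v, ‖fderiv ℝ ψ v‖ ≤ C := by
  obtain ⟨C, hC⟩ := (h.2.fderiv ℝ).exists_bound_of_continuous (h.1.continuous_fderiv (by simp))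
  exact ⟨C, (norm_nonneg _).trans (hC 0), hC⟩

lemma Tst.integrable (h : Tst ψ) : Integrable ψ := h.cont.integrable_of_hasCompactSupport h.2

lemma PP_integrand_int (h : Tst ψ) (t : ℝ) (w : Evec N) :
    Integrable (fun z => ga N z * ψ (exp (-t) • w + aa t • z)) := by
  obtain ⟨C, hC0, hC⟩ := h.bdd
  refine (ga_int N).mul_bdd (c := C) ?_ (ae_of_all _ fun z => hC _)
  have := h.cont
  exact Continuous.aestronglyMeasurable (by fun_prop)

lemma PP_bdd {C : ℝ} (hC : ∀ v, |ψ v| ≤ C) (t : ℝ) (w : Evec N) :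
    |PP t ψ w| ≤ C := by
  have h1 : ∀ z, ‖ga N z * ψ (exp (-t) • w + aa t • z)‖ ≤ ga N z * C := fun z => by
    rw [norm_mul, Real.norm_of_nonneg (ga_nonneg N z)]
    exact mul_le_mul_of_nonneg_left (hC _) (ga_nonneg N z)
  have := norm_integral_le_of_norm_le ((ga_int N).mul_const C) (ae_of_all _ h1)
  rwa [integral_mul_const, ga_one, one_mul] at this

lemma PP_cont (h : Tst ψ) : Continuous (fun x : ℝ × Evec N => PP x.1 ψ x.2) := by
  obtain ⟨C, hC0, hC⟩ := h.bdd
  unfold PP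
  have hc := h.cont
  have hg := ga_cont N
  have ha := aa_cont
  refine continuous_of_dominated (bound := fun z => ga N z * C) ?_ ?_ ((ga_int N).mul_const C) ?_
  · intro x; exact Continuous.aestronglyMeasurable (by fun_prop)
  · intro x; refine ae_of_all _ fun z => ?_
    rw [norm_mul, Real.norm_of_nonneg (ga_nonneg N z)]
    exact mul_le_mul_of_nonneg_left (hC _) (ga_nonneg N z)
  · refine ae_of_all _ fun z => ?_
    fun_prop

lemma PP_zero (w : Evec N) : PP 0 ψ w = ψ w := by
  simp [PP, aa_zero, integral_mul_const, ga_one]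

lemma QQ_eq (h : Tst ψ) (t : ℝ) (w : Evec N) :
    QQ t ψ w = exp (-t) * ∑ i, w i * PP t (DD (ee i) ψ) w := by
  unfold QQ
  congr 1
  unfold PP
  simp only [← integral_const_mul]
  rw [← integral_finsetSum]
  · congr 1; ext z
    show _ * (fderiv ℝ ψ _ w) = _
    rw [fderiv_sum_ee, Finset.mul_sum]
    exact Finset.sum_congr rfl fun i _ => by ring
  · intro i _; exact (PP_integrand_int (h.dd _) t w).const_mul _

lemma QQ_cont (h : Tst ψ) : Continuous (fun x : ℝ × Evec N => QQ x.1 ψ x.2) := by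
  simp only [QQ_eq h]
  have := fun i => PP_cont (h.dd (ee i))
  fun_prop

lemma QQ_zero (w : Evec N) : QQ 0 ψ w = fderiv ℝ ψ w w := by
  simp [QQ, PP_zero, DD]

lemma QQ_bdd {C : ℝ} (hC : ∀ v, ‖fderiv ℝ ψ v‖ ≤ C) {t : ℝ} (ht : 0 ≤ t)
    (w : Evec N) : |QQ t ψ w| ≤ C * ‖w‖ := by
  unfold QQ
  have h1 : |PP t (DD w ψ) w| ≤ C * ‖w‖ := by
    refine PP_bdd (fun v => ?_) t w
    exact (ContinuousLinearMap.le_opNorm _ _).trans (mul_le_mul_of_nonneg_right (hC v) (norm_nonneg _))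
  rw [abs_mul, abs_of_pos (exp_pos _)]
  have h2 : exp (-t) ≤ 1 := by rw [Real.exp_le_one_iff]; linarith
  calc _ ≤ 1 * (C * ‖w‖) := by gcongr
    _ = _ := one_mul _

lemma aa_deriv {t : ℝ} (ht : 0 < t) : HasDerivAt aa (exp (-2 * t) / aa t) t := by
  have h1 : aa =ᶠ[𝓝 t] fun x => √(1 - exp (-2 * x)) := by
    filter_upwards [Ioi_mem_nhds ht] with x hx
    rw [← aa_sq (le_of_lt hx), Real.sqrt_sq (aa_pos hx).le]
  have h0 : 1 - exp (-2 * t) ≠ 0 := by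
    rw [← aa_sq ht.le]; exact (pow_pos (aa_pos ht) 2).ne'
  have h2 : HasDerivAt (fun x => 1 - exp (-2 * x)) (2 * exp (-2 * t)) t := by
    have := ((hasDerivAt_id t).const_mul (-2)).exp.const_sub 1
    refine this.congr_deriv ?_; simp; ring
  have h3 := (h2.sqrt h0).congr_of_eventuallyEq h1
  refine h3.congr_deriv ?_
  rw [← aa_sq ht.le, Real.sqrt_sq (aa_pos ht).le]
  have := aa_pos ht
  field_simp

/-- Integration by parts. -/
lemma ibp {f g : Evec N → ℝ} (hf : ContDiff ℝ 1 f) (hg : ContDiff ℝ 1 g)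
    (hc : HasCompactSupport g) (u : Evec N) :
    ∫ x, f x * fderiv ℝ g x u = - ∫ x, fderiv ℝ f x u * g x := by
  have c1 := hf.continuous_fderiv (by simp)
  have c2 := hg.continuous_fderiv (by simp)
  have c3 := hf.continuous
  have c4 := hg.continuous
  apply integral_mul_fderiv_eq_neg_fderiv_mul_of_integrable
  · exact Continuous.integrable_of_hasCompactSupport (by fun_prop) hc.mul_left
  · exact Continuous.integrable_of_hasCompactSupport (by fun_prop) (hc.fderiv_apply ℝ u).mul_left
  · exact Continuous.integrable_of_hasCompactSupport (by fun_prop) hc.mul_left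
  · exact fun x _ => hf.differentiable (by simp) x
  · exact fun x _ => hg.differentiable (by simp) x

lemma ga_fderiv (z u : Evec N) : fderiv ℝ (ga N) z u = - (ga N z * inner ℝ z u) := by
  have h : HasFDerivAt (ga N) ((2 * π) ^ (-(N : ℝ) / 2) • (exp (-(1/2) * ‖z‖ ^ 2) •
      ((-(1/2) : ℝ) • (2 • innerSL ℝ z)))) z := by
    unfold ga
    exact (((hasStrictFDerivAt_norm_sq z).hasFDerivAt.const_mul _).exp).const_mul _
  rw [h.fderiv]
  simp [ga]
  ring

/-- Gaussian IBP -/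
lemma gauss_ibp (h : Tst ψ) {t : ℝ} (ht : 0 < t) (w : Evec N) :
    ∫ z, ga N z * fderiv ℝ ψ (exp (-t) • w + aa t • z) z = aa t * PP t (Lap ψ) w := by
  have key : ∀ i, ∫ z, ga N z * (z i * DD (ee i) ψ (exp (-t) • w + aa t • z)) =
      aa t * PP t (DD (ee i) (DD (ee i) ψ)) w := by
    intro i
    have ha := aa_pos ht
    set χ := DD (ee i) ψ with hχ
    have hT : Tst χ := h.dd _
    set g : Evec N → ℝ := fun z => χ (exp (-t) • w + aa t • z) with hg
    have hg1 : ContDiff ℝ 1 g := (hT.1.of_le (by simp)).comp (by fun_prop)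
    have hgc : HasCompactSupport g := by
      have := hT.2.comp_homeomorph ((Homeomorph.smulOfNeZero (aa t) ha.ne').trans
        (Homeomorph.addLeft (exp (-t) • w)))
      exact this
    have hd : ∀ z, fderiv ℝ g z (ee i) = aa t * DD (ee i) χ (exp (-t) • w + aa t • z) := by
      intro z
      have h1 : HasFDerivAt (fun z : Evec N => exp (-t) • w + aa t • z)
          (aa t • ContinuousLinearMap.id ℝ (Evec N)) z :=
        ((hasFDerivAt_id z).const_smul (aa t)).const_add _
      have h2 := (hT.diff (exp (-t) • w + aa t • z)).hasFDerivAt.comp z h1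
      have h3 : fderiv ℝ g z = _ := h2.fderiv
      rw [h3]
      simp [DD]
    have := ibp ((ga_contDiff N).of_le (by simp)) hg1 hgc (ee i)
    simp only [hd, ga_fderiv] at this
    unfold PP
    rw [← integral_const_mul]
    have e1 : ∀ z : Evec N, inner ℝ z (ee i) = z i := fun z => by
      simp [ee, EuclideanSpace.inner_single_right]
    simp only [e1] at this
    rw [← integral_neg] at this
    calc _ = ∫ z, -(-(ga N z * z i) * g z) := by congr 1; ext z; simp [hg]; ring
      _ = _ := by rw [← this]; congr 1; ext z; ring
  simp only [fderiv_sum_ee, Finset.mul_sum]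
  rw [integral_finsetSum]
  · rw [Finset.sum_congr rfl fun i _ => key i, ← Finset.mul_sum]
    congr 1
    unfold PP Lap
    simp only [Finset.mul_sum]
    rw [integral_finsetSum]
    intro i _
    exact PP_integrand_int ((h.dd _).dd _) t w
  · intro i _
    obtain ⟨C, hC0, hC⟩ := (h.dd (ee i)).bdd
    have hc := (h.dd (ee i)).cont
    have hg := ga_cont N
    refine ((ga_norm_int N).mul_const C).mono' (Continuous.aestronglyMeasurable (by fun_prop))
      (ae_of_all _ fun z => ?_)
    rw [norm_mul, norm_mul, Real.norm_of_nonneg (ga_nonneg N z), mul_assoc]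
    have := ga_nonneg N z
    gcongr
    · exact PiLp.norm_apply_le z i
    · exact hC _

lemma PP_deriv (h : Tst ψ) {t : ℝ} (ht : 0 < t) (w : Evec N) :
    HasDerivAt (fun s => PP s ψ w) (PP t (LL ψ) w) t := by
  have ha := aa_pos ht
  obtain ⟨C, hC0, hC⟩ := h.bdd'
  have hg := ga_cont N
  have hc := h.cont
  have hcf : Continuous (fderiv ℝ ψ) := h.1.continuous_fderiv (by simp)
  set A := |exp (-2 * t) / aa t| + 1 with hA
  set s := {x | |exp (-2 * x) / aa x| < A} ∩ Set.Ioi 0 with hs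
  have hsn : s ∈ 𝓝 t := by
    refine inter_mem ?_ (Ioi_mem_nhds ht)
    have hcont : ContinuousAt (fun x => |exp (-2 * x) / aa x|) t :=
      (ContinuousAt.div (by fun_prop) aa_cont.continuousAt ha.ne').abs
    exact hcont.eventually_lt continuousAt_const (by simp [hA])
  have main := hasDerivAt_integral_of_dominated_loc_of_deriv_le (μ := (volume : Measure (Evec N)))
    (F := fun x z => ga N z * ψ (exp (-x) • w + aa x • z))
    (F' := fun x z => ga N z * fderiv ℝ ψ (exp (-x) • w + aa x • z)
      ((-exp (-x)) • w + (exp (-2 * x) / aa x) • z))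
    (bound := fun z => C * ‖w‖ * ga N z + C * A * (ga N z * ‖z‖)) hsn
    (Eventually.of_forall fun x => Continuous.aestronglyMeasurable (by fun_prop))
    (PP_integrand_int h t w) (Continuous.aestronglyMeasurable (by fun_prop))
    (ae_of_all _ fun z x hx => ?_)
    (((ga_int N).const_mul _).add ((ga_norm_int N).const_mul _))
    (ae_of_all _ fun z x hx => ?_)
  · refine main.2.congr_deriv ?_
    have hi1 : Integrable (fun z => ga N z * fderiv ℝ ψ (exp (-t) • w + aa t • z) w) :=
      PP_integrand_int (h.dd w) t w
    have hi2 : Integrable (fun z => ga N z * fderiv ℝ ψ (exp (-t) • w + aa t • z) z) := by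
      refine ((ga_norm_int N).mul_const C).mono' (Continuous.aestronglyMeasurable (by fun_prop))
        (ae_of_all _ fun z => ?_)
      rw [norm_mul, Real.norm_of_nonneg (ga_nonneg N z), mul_assoc, mul_comm ‖z‖]
      have := ga_nonneg N z
      gcongr
      exact (ContinuousLinearMap.le_opNorm _ _).trans (mul_le_mul_of_nonneg_right (hC _) (norm_nonneg _))
    have hi3 := PP_integrand_int h.lap t w
    have e1 : PP t (LL ψ) w = PP t (Lap ψ) w
        - exp (-t) * (∫ z, ga N z * fderiv ℝ ψ (exp (-t) • w + aa t • z) w)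
        - aa t * (∫ z, ga N z * fderiv ℝ ψ (exp (-t) • w + aa t • z) z) := by
      unfold PP
      have i1 := integral_sub hi3 (hi1.const_mul (exp (-t)))
      have i2 := integral_sub (hi3.sub (hi1.const_mul (exp (-t)))) (hi2.const_mul (aa t))
      simp only [Pi.sub_apply] at i2
      rw [← integral_const_mul, ← integral_const_mul, ← i1, ← i2]
      congr 1; ext z
      simp only [LL, map_add, map_smul, smul_eq_mul]
      ring
    have e2 : (∫ z, ga N z * fderiv ℝ ψ (exp (-t) • w + aa t • z)
        ((-exp (-t)) • w + (exp (-2 * t) / aa t) • z)) =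
        - exp (-t) * (∫ z, ga N z * fderiv ℝ ψ (exp (-t) • w + aa t • z) w)
        + (exp (-2 * t) / aa t) * (∫ z, ga N z * fderiv ℝ ψ (exp (-t) • w + aa t • z) z) := by
      rw [← integral_const_mul, ← integral_const_mul,
        ← integral_add (hi1.const_mul _) (hi2.const_mul _)]
      congr 1; ext z
      simp only [map_add, map_smul, smul_eq_mul]
      ring
    refine Eq.trans e2 (Eq.trans ?_ e1.symm)
    rw [gauss_ibp h ht w]
    have h4 : exp (-2 * t) = 1 - aa t ^ 2 := by rw [aa_sq ht.le]; ring
    rw [h4]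
    field_simp
    ring
  · have hx0 : 0 < x := hx.2
    have hx1 : |exp (-2 * x) / aa x| < A := hx.1
    rw [norm_mul, Real.norm_of_nonneg (ga_nonneg N z)]
    have h1 : ‖(-exp (-x)) • w + (exp (-2 * x) / aa x) • z‖ ≤ ‖w‖ + A * ‖z‖ := by
      refine (norm_add_le _ _).trans ?_
      rw [norm_smul, norm_smul, norm_neg, Real.norm_of_nonneg (exp_pos _).le, Real.norm_eq_abs]
      have h2 : exp (-x) ≤ 1 := by rw [Real.exp_le_one_iff]; linarith
      have := mul_le_mul_of_nonneg_right h2 (norm_nonneg w)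
      have := mul_le_mul_of_nonneg_right hx1.le (norm_nonneg z)
      linarith
    have h3 := (ContinuousLinearMap.le_opNorm (fderiv ℝ ψ (exp (-x) • w + aa x • z))
      ((-exp (-x)) • w + (exp (-2 * x) / aa x) • z)).trans
      (mul_le_mul (hC _) h1 (norm_nonneg _) hC0)
    have := mul_le_mul_of_nonneg_left h3 (ga_nonneg N z)
    refine this.trans (le_of_eq (by ring))
  · have hx0 : 0 < x := hx.2
    have h1 : HasDerivAt (fun x => exp (-x) • w + aa x • z)
        ((-exp (-x)) • w + (exp (-2 * x) / aa x) • z) x := by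
      have e := (hasDerivAt_neg x).exp
      have e' : HasDerivAt (fun x => exp (-x)) (-exp (-x)) x := e.congr_deriv (by ring)
      exact (e'.smul_const w).fun_add ((aa_deriv hx0).smul_const z)
    have h2 := (h.diff (exp (-x) • w + aa x • z)).hasFDerivAt.comp_hasDerivAt x h1
    exact h2.const_mul (ga N z)

lemma PP_cont_left (h : Tst ψ) (w : Evec N) : Continuous (fun s => PP s ψ w) :=
  Continuous.comp (g := fun x : ℝ × Evec N => PP x.1 ψ x.2) (f := fun s => (s, w)) (PP_cont h)
    (by fun_prop)

lemma QQ_cont_left (h : Tst ψ) (w : Evec N) : Continuous (fun s => QQ s ψ w) :=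
  Continuous.comp (g := fun x : ℝ × Evec N => QQ x.1 ψ x.2) (f := fun s => (s, w)) (QQ_cont h)
    (by fun_prop)

lemma PP_ftc (h : Tst ψ) {t : ℝ} (ht : 0 ≤ t) (w : Evec N) :
    ∫ s in (0:ℝ)..t, PP s (LL ψ) w = PP t ψ w - ψ w := by
  have hc : Continuous (fun s => PP s (LL ψ) w) :=
    PP_cont_left h.ll w
  have hc' : Continuous (fun s => PP s ψ w) :=
    PP_cont_left h w
  rw [intervalIntegral.integral_eq_sub_of_hasDerivAt_of_le ht hc'.continuousOn
    (fun x hx => PP_deriv h hx.1 w) (hc.intervalIntegrable _ _), PP_zero]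

lemma DD_comm (h : Tst ψ) (u u' : Evec N) : DD u (DD u' ψ) = DD u' (DD u ψ) := by
  ext v
  have hd : DifferentiableAt ℝ (fderiv ℝ ψ) v :=
    (h.1.fderiv_right (m := ∞) (by simp)).differentiable (by simp) v
  have e : ∀ a b, DD a (DD b ψ) v = fderiv ℝ (fderiv ℝ ψ) v a b := by
    intro a b
    unfold DD
    rw [fderiv_clm_apply hd (differentiableAt_const _)]
    simp
  rw [e, e]
  have h2 : ContDiff ℝ 2 ψ := contDiff_infty.1 h.1 2
  exact (h2.contDiffAt.isSymmSndFDerivAt (by simp)).eq u u'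

lemma DD_LL (h : Tst ψ) (u v : Evec N) : DD u (LL ψ) v = LL (DD u ψ) v - DD u ψ v := by
  have hd : DifferentiableAt ℝ (fderiv ℝ ψ) v :=
    (h.1.fderiv_right (m := ∞) (by simp)).differentiable (by simp) v
  have e1 : DD u (Lap ψ) v = Lap (DD u ψ) v := by
    show fderiv ℝ (fun v => ∑ i, DD (ee i) (DD (ee i) ψ) v) v u = _
    rw [fderiv_fun_sum fun i _ => ((h.dd _).dd _).diff v]
    simp only [sum_apply, Lap]
    refine Finset.sum_congr rfl fun i _ => ?_
    show DD u (DD (ee i) (DD (ee i) ψ)) v = _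
    rw [DD_comm (h.dd _) u, DD_comm h u]
  have e2 : DD u (fun v => fderiv ℝ ψ v v) v = fderiv ℝ (DD u ψ) v v + DD u ψ v := by
    have e3 : fderiv ℝ (DD u ψ) v v = DD u (DD v ψ) v := by rw [DD_comm h]; rfl
    rw [e3]
    unfold DD
    rw [fderiv_clm_apply hd differentiableAt_fun_id, fderiv_clm_apply hd (differentiableAt_const _)]
    simp; ring
  have e4 : DD u (LL ψ) v = DD u (Lap ψ) v - DD u (fun v => fderiv ℝ ψ v v) v := by
    show fderiv ℝ (fun v => Lap ψ v - fderiv ℝ ψ v v) v u = _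
    rw [fderiv_fun_sub (h.lap.diff v) (h.euler.diff v)]; rfl
  rw [e4, e1, e2]; unfold LL; ring

lemma QQ_ftc (h : Tst ψ) {t : ℝ} (ht : 0 ≤ t) (w : Evec N) :
    ∫ s in (0:ℝ)..t, QQ s (LL ψ) w = QQ t ψ w - fderiv ℝ ψ w w := by
  have hc : Continuous (fun s => QQ s (LL ψ) w) :=
    QQ_cont_left h.ll w
  have hc' : Continuous (fun s => QQ s ψ w) :=
    QQ_cont_left h w
  rw [intervalIntegral.integral_eq_sub_of_hasDerivAt_of_le ht hc'.continuousOn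
    (fun x hx => ?_) (hc.intervalIntegrable _ _), QQ_zero]
  have e : HasDerivAt (fun x => exp (-x)) (-exp (-x)) x := by
    exact (hasDerivAt_neg x).exp.congr_deriv (by ring)
  have := e.mul (PP_deriv (h.dd w) hx.1 w)
  refine this.congr_deriv ?_
  unfold QQ
  have e1 : PP x (DD w (LL ψ)) w = PP x (LL (DD w ψ)) w - PP x (DD w ψ) w := by
    unfold PP
    rw [← integral_sub (PP_integrand_int (h.dd w).ll x w) (PP_integrand_int (h.dd w) x w)]
    congr 1; ext z; rw [DD_LL h]; ring
  rw [e1]; ring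

end

structure Nice (N : ℕ) (M : ℝ) (f : ℝ → Evec N → ℝ) : Prop where
  meas : Measurable (Function.uncurry f)
  bdd : ∀ s w, |f s w| ≤ M
  int : ∀ s, Integrable (fun w => (1 + ‖w‖) * |f s w|)
  l1 : ∀ s, ∫ w, (1 + ‖w‖) * |f s w| ≤ M

lemma fub3 {α β γ : Type*} [MeasurableSpace α] [MeasurableSpace β] [MeasurableSpace γ]
    {μ : Measure α} {ν : Measure β} {ρ : Measure γ} [SFinite μ] [SFinite ν] [SFinite ρ]
    {K : (α × β) × γ → ℝ} (hK : Integrable K ((μ.prod ν).prod ρ)) :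
    ∫ c, ∫ a, ∫ b, K ((a, b), c) ∂ν ∂μ ∂ρ = ∫ a, ∫ b, ∫ c, K ((a, b), c) ∂ρ ∂ν ∂μ := by
  have h1 : ∫ c, ∫ a, ∫ b, K ((a, b), c) ∂ν ∂μ ∂ρ = ∫ c, ∫ x, K (x, c) ∂(μ.prod ν) ∂ρ := by
    refine integral_congr_ae ?_
    filter_upwards [hK.prod_left_ae] with c hc
    rw [integral_prod _ hc]
  have h2 : ∫ c, ∫ x, K (x, c) ∂(μ.prod ν) ∂ρ = ∫ x, ∫ c, K (x, c) ∂ρ ∂(μ.prod ν) :=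
    (integral_integral_swap (f := fun x c => K (x, c)) hK).symm
  rw [h1, h2, integral_prod _ hK.integral_prod_left]

section
variable {N : ℕ} {ψ : Evec N → ℝ} {f : ℝ → Evec N → ℝ} {M : ℝ}

lemma Nice.meas1 (hf : Nice N M f) (s : ℝ) : Measurable (f s) :=
  hf.meas.comp (measurable_const.prodMk measurable_id)

lemma Nice.M0 (hf : Nice N M f) : 0 ≤ M := (abs_nonneg _).trans (hf.bdd 0 0)

lemma Nice.integrable (hf : Nice N M f) (s : ℝ) : Integrable (f s) := by
  refine (hf.int s).mono' (hf.meas1 s).aestronglyMeasurable (ae_of_all _ fun w => ?_)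
  rw [Real.norm_eq_abs]
  nlinarith [norm_nonneg w, abs_nonneg (f s w)]

lemma Nice.sq_le (hf : Nice N M f) (s : ℝ) (w : Evec N) :
    ‖w‖ * f s w ^ 2 ≤ M * ((1 + ‖w‖) * |f s w|) := by
  have h1 := hf.bdd s w
  have h2 : f s w ^ 2 ≤ M * |f s w| := by
    rw [← sq_abs]; nlinarith [abs_nonneg (f s w)]
  have := hf.M0
  nlinarith [norm_nonneg w, mul_nonneg this (abs_nonneg (f s w)),
    mul_le_mul_of_nonneg_left h2 (norm_nonneg w)]

lemma Nice.sq_int (hf : Nice N M f) (s : ℝ) : Integrable (fun w => ‖w‖ * f s w ^ 2) := by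
  refine ((hf.int s).const_mul M).mono' ?_ (ae_of_all _ fun w => ?_)
  · exact (measurable_norm.mul ((hf.meas1 s).pow_const 2)).aestronglyMeasurable
  · rw [Real.norm_of_nonneg (by positivity)]
    exact hf.sq_le s w

lemma Nice.sq_l1 (hf : Nice N M f) (s : ℝ) : ∫ w, ‖w‖ * f s w ^ 2 ≤ M * M := by
  calc _ ≤ ∫ w, M * ((1 + ‖w‖) * |f s w|) :=
        integral_mono (hf.sq_int s) ((hf.int s).const_mul M) (hf.sq_le s)
    _ ≤ _ := by
        rw [integral_const_mul]
        exact mul_le_mul_of_nonneg_left (hf.l1 s) hf.M0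

lemma FP_contDiff (t : ℝ) (w : Evec N) : ContDiff ℝ 1 (fun v => FPkernel N t v w) := by
  unfold FPkernel
  have : ContDiff ℝ 1 (fun v : Evec N => ‖exp t • v - w‖ ^ 2) := by
    apply ContDiff.norm_sq ℝ
    fun_prop
  exact contDiff_const.mul ((this.neg.div_const _).exp)

lemma FP_nonneg (t : ℝ) (ht : 0 < t) (v w : Evec N) : 0 ≤ FPkernel N t v w := by
  unfold FPkernel
  have := nu_pos ht
  positivity

lemma FP_fderiv (t : ℝ) (v w u : Evec N) : fderiv ℝ (fun v => FPkernel N t v w) v u =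
    - (exp t * inner ℝ (exp t • v - w) u / (exp (2 * t) - 1)) * FPkernel N t v w := by
  have h0 : HasFDerivAt (fun v : Evec N => exp t • v - w)
      (exp t • ContinuousLinearMap.id ℝ (Evec N)) v :=
    ((hasFDerivAt_id v).const_smul (exp t)).sub_const _
  have h1 := h0.norm_sq
  have h2 := ((((h1.neg).mul_const (2 * (exp (2 * t) - 1))⁻¹).exp).const_mul
    (exp ((N : ℝ) * t) * (2 * π * (exp (2 * t) - 1)) ^ (-(N : ℝ) / 2)))
  have h3 : HasFDerivAt (fun v => FPkernel N t v w) _ v := h2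
  rw [h3.fderiv]
  simp only [FPkernel, div_eq_mul_inv]
  simp [inner_sub_left, real_inner_smul_left]
  ring

lemma FP_meas : Measurable (fun x : (ℝ × Evec N) × Evec N => FPkernel N x.1.1 x.2 x.1.2) := by
  unfold FPkernel
  fun_prop

lemma FP_fderiv_meas : Measurable (fun x : (ℝ × Evec N) × Evec N =>
    fderiv ℝ (fun v => FPkernel N x.1.1 v x.1.2) x.2 x.1.2) := by
  simp only [FP_fderiv]
  have := FP_meas (N := N)
  fun_prop

/-- L1 bound of the kernel derivative -/
lemma FP_l1 {t : ℝ} (ht : 0 < t) (w : Evec N) :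
    Integrable (fun v => ‖exp t • v - w‖ * FPkernel N t v w) ∧
    ∫ v, ‖exp t • v - w‖ * FPkernel N t v w = √(exp (2 * t) - 1) * ∫ z, ga N z * ‖z‖ := by
  have h1 : ∀ z : Evec N, ‖exp t • (exp (-t) • w + aa t • z) - w‖ = √(exp (2 * t) - 1) * ‖z‖ := by
    intro z
    have : exp t • (exp (-t) • w + aa t • z) - w = √(exp (2 * t) - 1) • z := by
      rw [smul_add, smul_smul, smul_smul, ← Real.exp_add]
      unfold aa
      rw [← mul_assoc, ← Real.exp_add]
      simp
    rw [this, norm_smul, Real.norm_of_nonneg (Real.sqrt_nonneg _)]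
  have e1 := FP_subst_int ht w (fun v => ‖exp t • v - w‖)
  have e2 := FP_subst ht w (fun v => ‖exp t • v - w‖)
  simp only [h1] at e1 e2
  have h3 : ∀ z : Evec N, ga N z * (√(exp (2 * t) - 1) * ‖z‖) =
    √(exp (2 * t) - 1) * (ga N z * ‖z‖) := fun z => by ring
  simp only [h3] at e1 e2
  simp only [mul_comm ‖_‖ (FPkernel N t _ w)]
  refine ⟨e1.2 ((ga_norm_int N).const_mul _), ?_⟩
  rw [e2, integral_const_mul]

lemma sing_int {t : ℝ} (ht : 0 ≤ t) : IntegrableOn (fun s => (t - s) ^ (-(1/2) : ℝ)) (Set.Ioc 0 t) := by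
  have h := (intervalIntegral.intervalIntegrable_rpow' (a := 0) (b := t)
    (r := -(1/2)) (by norm_num)).comp_sub_left t
  simp only [sub_zero, sub_self] at h
  exact (intervalIntegrable_iff_integrableOn_Ioc_of_le ht).1 h.symm

lemma nu_sqrt {t : ℝ} (ht : 0 < t) : √(exp (2 * t) - 1) / (exp (2 * t) - 1) ≤ t ^ (-(1/2) : ℝ) := by
  have h := nu_pos ht
  rw [Real.sqrt_div_self', Real.rpow_neg ht.le, ← Real.sqrt_eq_rpow, one_div]
  have h2 : t ≤ exp (2 * t) - 1 := by linarith [Real.add_one_le_exp (2 * t)]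
  have := Real.sqrt_pos.2 ht
  gcongr

lemma kern_int (hf : Nice N M f) (hψ : Tst ψ) {t : ℝ} (ht : 0 < t) :
    Integrable (fun x : (ℝ × Evec N) × Evec N => ψ x.2 * (exp (-(t - x.1.1)) *
      (fderiv ℝ (fun u => FPkernel N (t - x.1.1) u x.1.2) x.2 x.1.2 * f x.1.1 x.1.2 ^ 2)))
      (((volume.restrict (Set.Ioc 0 t)).prod volume).prod volume) := by
  obtain ⟨C, hC0, hC⟩ := hψ.bdd
  set m1 := ∫ z, ga N z * ‖z‖ with hm1
  have hm10 : 0 ≤ m1 := integral_nonneg fun z => mul_nonneg (ga_nonneg N z) (norm_nonneg z)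
  have hmeas : Measurable (fun x : (ℝ × Evec N) × Evec N => ψ x.2 * (exp (-(t - x.1.1)) *
      (fderiv ℝ (fun u => FPkernel N (t - x.1.1) u x.1.2) x.2 x.1.2 * f x.1.1 x.1.2 ^ 2))) := by
    have h1 : Measurable (fun x : (ℝ × Evec N) × Evec N =>
        fderiv ℝ (fun u => FPkernel N (t - x.1.1) u x.1.2) x.2 x.1.2) :=
      FP_fderiv_meas.comp (g := fun x : (ℝ × Evec N) × Evec N =>
        fderiv ℝ (fun v => FPkernel N x.1.1 v x.1.2) x.2 x.1.2)
        (f := fun x : (ℝ × Evec N) × Evec N => ((t - x.1.1, x.1.2), x.2)) (by fun_prop)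
    have h2 : Measurable (fun x : (ℝ × Evec N) × Evec N => f x.1.1 x.1.2) :=
      hf.meas.comp measurable_fst
    have h3 := hψ.cont.measurable
    have h4 : Measurable (fun x : (ℝ × Evec N) × Evec N => exp (-(t - x.1.1))) := by fun_prop
    exact (h3.comp measurable_snd).mul (h4.mul (h1.mul (h2.pow_const 2)))
  refine ⟨hmeas.aestronglyMeasurable, ?_⟩
  unfold HasFiniteIntegral
  have step1 : ∀ s w, s < t → ∫⁻ v, ‖ψ v * (exp (-(t - s)) *
      (fderiv ℝ (fun u => FPkernel N (t - s) u w) v w * f s w ^ 2))‖ₑ ≤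
      ENNReal.ofReal (C * m1 * (t - s) ^ (-(1/2) : ℝ) * (‖w‖ * f s w ^ 2)) := by
    intro s w hs
    have hτ : 0 < t - s := sub_pos.2 hs
    have hn := nu_pos hτ
    obtain ⟨i1, i2⟩ := FP_l1 hτ w
    have hb : ∀ v, ‖ψ v * (exp (-(t - s)) *
      (fderiv ℝ (fun u => FPkernel N (t - s) u w) v w * f s w ^ 2))‖ ≤
      (C * (‖w‖ * f s w ^ 2) / (exp (2 * (t - s)) - 1)) *
        (‖exp (t - s) • v - w‖ * FPkernel N (t - s) v w) := by
      intro v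
      have hF := FP_nonneg (t - s) hτ v w
      rw [FP_fderiv, norm_mul, norm_mul, norm_mul, norm_mul, norm_neg, norm_div, norm_mul,
        Real.norm_of_nonneg hF, Real.norm_of_nonneg (exp_pos _).le,
        Real.norm_of_nonneg (exp_pos _).le, Real.norm_of_nonneg hn.le,
        Real.norm_of_nonneg (sq_nonneg (f s w)), Real.exp_neg]
      have e1 := exp_pos (t - s)
      calc _ ≤ C * ((exp (t - s))⁻¹ * ((exp (t - s) * (‖exp (t - s) • v - w‖ * ‖w‖) /
            (exp (2 * (t - s)) - 1) * FPkernel N (t - s) v w) * f s w ^ 2)) := by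
            gcongr
            · exact hC v
            · exact abs_real_inner_le_norm _ _
        _ = _ := by field_simp
    calc _ ≤ ∫⁻ v, ENNReal.ofReal ((C * (‖w‖ * f s w ^ 2) / (exp (2 * (t - s)) - 1)) *
        (‖exp (t - s) • v - w‖ * FPkernel N (t - s) v w)) := by
          refine lintegral_mono fun v => ?_
          rw [← ofReal_norm]
          exact ENNReal.ofReal_le_ofReal (hb v)
      _ = ENNReal.ofReal (∫ v, (C * (‖w‖ * f s w ^ 2) / (exp (2 * (t - s)) - 1)) *
        (‖exp (t - s) • v - w‖ * FPkernel N (t - s) v w)) := by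
          rw [ofReal_integral_eq_lintegral_ofReal (i1.const_mul _)]
          exact ae_of_all _ fun v => (norm_nonneg _).trans (hb v)
      _ ≤ _ := by
          rw [integral_const_mul, i2]
          apply ENNReal.ofReal_le_ofReal
          calc _ = C * m1 * (√(exp (2 * (t - s)) - 1) / (exp (2 * (t - s)) - 1)) *
                (‖w‖ * f s w ^ 2) := by ring
            _ ≤ _ := by gcongr; exact nu_sqrt hτ
  have step2 : ∀ s, s < t → ∫⁻ w, ∫⁻ v, ‖ψ v * (exp (-(t - s)) *
      (fderiv ℝ (fun u => FPkernel N (t - s) u w) v w * f s w ^ 2))‖ₑ ≤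
      ENNReal.ofReal (C * m1 * (M * M) * (t - s) ^ (-(1/2) : ℝ)) := by
    intro s hs
    have hτ : 0 < t - s := sub_pos.2 hs
    have hp : 0 ≤ (t - s) ^ (-(1/2) : ℝ) := Real.rpow_nonneg hτ.le _
    calc _ ≤ ∫⁻ w, ENNReal.ofReal (C * m1 * (t - s) ^ (-(1/2) : ℝ) * (‖w‖ * f s w ^ 2)) :=
          lintegral_mono fun w => step1 s w hs
      _ = ENNReal.ofReal (∫ w, C * m1 * (t - s) ^ (-(1/2) : ℝ) * (‖w‖ * f s w ^ 2)) := by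
          rw [ofReal_integral_eq_lintegral_ofReal ((hf.sq_int s).const_mul _)]
          exact ae_of_all _ fun w => by positivity
      _ ≤ _ := by
          rw [integral_const_mul]
          apply ENNReal.ofReal_le_ofReal
          calc _ ≤ C * m1 * (t - s) ^ (-(1/2) : ℝ) * (M * M) := by
                gcongr; exact hf.sq_l1 s
            _ = _ := by ring
  rw [lintegral_prod _ hmeas.enorm.aemeasurable,
    lintegral_prod _ hmeas.enorm.lintegral_prod_right'.aemeasurable]
  have hsing := (sing_int ht.le).const_mul (C * m1 * (M * M))
  have hlt : (fun s => ∫⁻ w, ∫⁻ v, ‖ψ v * (exp (-(t - s)) *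
      (fderiv ℝ (fun u => FPkernel N (t - s) u w) v w * f s w ^ 2))‖ₑ)
      ≤ᵐ[volume.restrict (Set.Ioc 0 t)]
      fun s => ENNReal.ofReal (C * m1 * (M * M) * (t - s) ^ (-(1/2) : ℝ)) := by
    have hne : ∀ᵐ s ∂(volume.restrict (Set.Ioc 0 t)), s ≠ t :=
      ae_restrict_of_ae (by simp [ae_iff])
    filter_upwards [hne, ae_restrict_mem measurableSet_Ioc] with s h1 h2
    exact step2 s (lt_of_le_of_ne h2.2 h1)
  refine (lintegral_mono_ae hlt).trans_lt ?_
  exact hsing.lintegral_lt_top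

/-- mild formula tested -/
lemma tested (hf : Nice N M f) (hψ : Tst ψ) {t : ℝ} (ht : 0 < t)
    (hm : ∀ᵐ v : Evec N, f t v = (∫ w : Evec N, FPkernel N t v w * f 0 w) +
      ∫ s in Set.Ioc (0 : ℝ) t, exp (-(t - s)) *
        ∫ w : Evec N, (fderiv ℝ (fun u => FPkernel N (t - s) u w) v w) * (f s w) ^ 2) :
    ∫ v, f t v * ψ v = (∫ w, f 0 w * PP t ψ w) -
      ∫ s in Set.Ioc (0 : ℝ) t, ∫ w, f s w ^ 2 * QQ (t - s) ψ w := by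
  have hk := kern_int hf hψ ht
  have hn := nu_pos ht
  -- first part
  have hA : Integrable (fun x : Evec N × Evec N => ψ x.1 * (FPkernel N t x.1 x.2 * f 0 x.2))
      (volume.prod volume) := by
    have h1 : Integrable (fun x : Evec N × Evec N => ψ x.1 * f 0 x.2) (volume.prod volume) :=
      hψ.integrable.mul_prod (hf.integrable 0)
    have h2 : Measurable (fun x : Evec N × Evec N => FPkernel N t x.1 x.2) :=
      FP_meas.comp (g := fun x : (ℝ × Evec N) × Evec N => FPkernel N x.1.1 x.2 x.1.2)
        (f := fun x : Evec N × Evec N => ((t, x.2), x.1)) (by fun_prop)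
    have h3 := h1.bdd_mul (c := exp ((N : ℝ) * t) * (2 * π * (exp (2 * t) - 1)) ^ (-(N : ℝ) / 2))
      h2.aestronglyMeasurable (ae_of_all _ fun x => ?_)
    · refine h3.congr (ae_of_all _ fun x => ?_)
      simp only; ring
    · rw [Real.norm_of_nonneg (FP_nonneg t ht _ _)]
      unfold FPkernel
      refine mul_le_of_le_one_right (by positivity) ?_
      rw [Real.exp_le_one_iff]
      exact div_nonpos_of_nonpos_of_nonneg (by simp) (by positivity)
  have eA : ∫ v, ψ v * (∫ w, FPkernel N t v w * f 0 w) = ∫ w, f 0 w * PP t ψ w := by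
    simp only [← integral_const_mul]
    rw [integral_integral_swap (f := fun v w => ψ v * (FPkernel N t v w * f 0 w)) hA]
    congr 1; ext w
    unfold PP
    rw [← FP_subst ht w ψ, ← integral_const_mul]
    congr 1; ext v; ring
  have iA : Integrable (fun v => ψ v * (∫ w, FPkernel N t v w * f 0 w)) := by
    simp only [← integral_const_mul]
    exact hA.integral_prod_left
  have eB0 : ∀ v, ψ v * ∫ s in Set.Ioc (0 : ℝ) t, exp (-(t - s)) *
        ∫ w : Evec N, (fderiv ℝ (fun u => FPkernel N (t - s) u w) v w) * (f s w) ^ 2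
      = ∫ s in Set.Ioc (0 : ℝ) t, ∫ w : Evec N, ψ v * (exp (-(t - s)) *
        ((fderiv ℝ (fun u => FPkernel N (t - s) u w) v w) * (f s w) ^ 2)) := fun v => by
    simp only [integral_const_mul]
  have eB : ∫ v, (ψ v * ∫ s in Set.Ioc (0 : ℝ) t, exp (-(t - s)) *
        ∫ w : Evec N, (fderiv ℝ (fun u => FPkernel N (t - s) u w) v w) * (f s w) ^ 2)
      = - ∫ s in Set.Ioc (0 : ℝ) t, ∫ w, f s w ^ 2 * QQ (t - s) ψ w := by
    simp only [eB0]
    rw [fub3 hk, ← integral_neg]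
    have hne : ∀ᵐ s ∂(volume.restrict (Set.Ioc 0 t)), s ≠ t :=
      ae_restrict_of_ae (by simp [ae_iff])
    refine integral_congr_ae ?_
    filter_upwards [hne, ae_restrict_mem measurableSet_Ioc] with s h1 h2
    have hτ : 0 < t - s := sub_pos.2 (lt_of_le_of_ne h2.2 h1)
    rw [← integral_neg]
    congr 1; ext w
    have e1 := ibp (FP_contDiff (t - s) w) (hψ.1.of_le (by simp)) hψ.2 w
    have e2 : ∫ v, FPkernel N (t - s) v w * fderiv ℝ ψ v w = PP (t - s) (DD w ψ) w :=
      FP_subst hτ w (DD w ψ)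
    rw [e2] at e1
    unfold QQ
    rw [e1]
    calc _ = ∫ v, (exp (-(t - s)) * f s w ^ 2) *
          (fderiv ℝ (fun u => FPkernel N (t - s) u w) v w * ψ v) := by
            congr 1; ext v; ring
      _ = _ := by rw [integral_const_mul]; ring
  have iB : Integrable (fun v => ψ v * ∫ s in Set.Ioc (0 : ℝ) t, exp (-(t - s)) *
        ∫ w : Evec N, (fderiv ℝ (fun u => FPkernel N (t - s) u w) v w) * (f s w) ^ 2) := by
    refine hk.integral_prod_right.congr ?_
    filter_upwards [hk.prod_left_ae] with v hv
    rw [eB0, integral_prod _ hv]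
  calc ∫ v, f t v * ψ v = ∫ v, (ψ v * (∫ w, FPkernel N t v w * f 0 w) +
        ψ v * ∫ s in Set.Ioc (0 : ℝ) t, exp (-(t - s)) *
        ∫ w : Evec N, (fderiv ℝ (fun u => FPkernel N (t - s) u w) v w) * (f s w) ^ 2) := by
        refine integral_congr_ae ?_
        filter_upwards [hm] with v hv
        rw [hv]; ring
    _ = _ := by rw [integral_add iA iB, eA, eB]; ring

end

def Mild (N : ℕ) (T : ℝ) (f : ℝ → Evec N → ℝ) : Prop :=
  ∀ t ∈ Set.Ioc (0 : ℝ) T, ∀ᵐ v : Evec N, f t v = (∫ w : Evec N, FPkernel N t v w * f 0 w) +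
      ∫ s in Set.Ioc (0 : ℝ) t, exp (-(t - s)) *
        ∫ w : Evec N, (fderiv ℝ (fun u => FPkernel N (t - s) u w) v w) * (f s w) ^ 2

section
variable {N : ℕ} {ψ : Evec N → ℝ} {f : ℝ → Evec N → ℝ} {M T : ℝ}

lemma inner_int (hψ : Tst ψ) {r t : ℝ} (hr : r ∈ Set.Ioc 0 t) (w : Evec N) :
    ∫ s in Set.Ioc 0 t, (if r ≤ s then QQ (s - r) (LL ψ) w else 0) =
      QQ (t - r) ψ w - fderiv ℝ ψ w w := by
  have h1 : ∫ s in Set.Ioc 0 t, (if r ≤ s then QQ (s - r) (LL ψ) w else 0) =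
      ∫ s in Set.Ioc r t, QQ (s - r) (LL ψ) w := by
    rw [← integral_Icc_eq_integral_Ioc (x := r)]
    have : Set.Icc r t = Set.Ioc 0 t ∩ Set.Ici r := by
      ext s; simp only [Set.mem_Icc, Set.mem_inter_iff, Set.mem_Ioc, Set.mem_Ici]
      constructor
      · rintro ⟨a, b⟩; exact ⟨⟨hr.1.trans_le a, b⟩, a⟩
      · rintro ⟨⟨a, b⟩, c⟩; exact ⟨c, b⟩
    rw [this, ← setIntegral_indicator measurableSet_Ici]
    congr 1
  rw [h1, ← intervalIntegral.integral_of_le hr.2]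
  rw [intervalIntegral.integral_comp_sub_right (fun s => QQ s (LL ψ) w) r, sub_self,
    QQ_ftc hψ (sub_nonneg.2 hr.2)]

lemma Nice.sq_meas (hf : Nice N M f) :
    Measurable (fun x : ℝ × Evec N => f x.1 x.2 ^ 2) := hf.meas.pow_const 2

lemma Nice.prod_int (hf : Nice N M f) (t : ℝ) :
    Integrable (fun x : ℝ × Evec N => ‖x.2‖ * f x.1 x.2 ^ 2)
      ((volume.restrict (Set.Ioc 0 t)).prod volume) := by
  have hm : Measurable (fun x : ℝ × Evec N => ‖x.2‖ * f x.1 x.2 ^ 2) :=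
    (measurable_norm.comp measurable_snd).mul hf.sq_meas
  rw [integrable_prod_iff hm.aestronglyMeasurable]
  refine ⟨ae_of_all _ fun s => hf.sq_int s, ?_⟩
  refine (integrable_const (M * M)).mono' ?_ (ae_of_all _ fun s => ?_)
  · exact hm.norm.stronglyMeasurable.integral_prod_right.aestronglyMeasurable
  · have : ∀ w, ‖‖w‖ * f s w ^ 2‖ = ‖w‖ * f s w ^ 2 := fun w => Real.norm_of_nonneg (by positivity)
    simp only [this]
    rw [Real.norm_of_nonneg (integral_nonneg fun w => by positivity)]
    exact hf.sq_l1 s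

lemma Nice.prod_int1 (hf : Nice N M f) (t : ℝ) :
    Integrable (fun x : ℝ × Evec N => f x.1 x.2)
      ((volume.restrict (Set.Ioc 0 t)).prod volume) := by
  have hm : Measurable (fun x : ℝ × Evec N => f x.1 x.2) := hf.meas
  rw [integrable_prod_iff hm.aestronglyMeasurable]
  refine ⟨ae_of_all _ fun s => hf.integrable s, ?_⟩
  refine (integrable_const M).mono' ?_ (ae_of_all _ fun s => ?_)
  · exact hm.norm.stronglyMeasurable.integral_prod_right.aestronglyMeasurable
  · rw [Real.norm_of_nonneg (integral_nonneg fun w => by positivity)]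
    refine le_trans (integral_mono (hf.integrable s).norm (hf.int s) fun w => ?_) (hf.l1 s)
    simp only [Real.norm_eq_abs]
    nlinarith [norm_nonneg w, abs_nonneg (f s w)]

set_option maxHeartbeats 1000000 in
lemma weak (hf : Nice N M f) (hm : Mild N T f) (hψ : Tst ψ) {t : ℝ} (ht : t ∈ Set.Icc 0 T) :
    ∫ v, f t v * ψ v = (∫ v, f 0 v * ψ v) +
      ∫ s in Set.Ioc (0 : ℝ) t, ((∫ w, f s w * LL ψ w) - ∫ w, f s w ^ 2 * fderiv ℝ ψ w w) := by
  rcases ht.1.eq_or_lt with h0 | h0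
  · subst h0; simp
  obtain ⟨C, hC0, hC⟩ := hψ.ll.bdd
  obtain ⟨C', hC0', hC'⟩ := hψ.ll.bdd'
  obtain ⟨C1, hC01, hC1⟩ := hψ.bdd
  obtain ⟨C2, hC02, hC2⟩ := hψ.bdd'
  set μ := volume.restrict (Set.Ioc (0:ℝ) t) with hμ
  -- first term
  have iA : Integrable (fun x : ℝ × Evec N => f 0 x.2 * PP x.1 (LL ψ) x.2) (μ.prod volume) := by
    have h1 : Integrable (fun x : ℝ × Evec N => (1:ℝ) * f 0 x.2) (μ.prod volume) :=
      (integrable_const (1:ℝ)).mul_prod (hf.integrable 0)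
    have h2 := h1.bdd_mul (c := C) (f := fun x : ℝ × Evec N => PP x.1 (LL ψ) x.2)
      (PP_cont hψ.ll).aestronglyMeasurable (ae_of_all _ fun x => PP_bdd hC x.1 x.2)
    exact h2.congr (ae_of_all _ fun x => by simp only; ring)
  have eA : ∫ s in Set.Ioc (0 : ℝ) t, ∫ w, f 0 w * PP s (LL ψ) w =
      (∫ w, f 0 w * PP t ψ w) - ∫ w, f 0 w * ψ w := by
    rw [integral_integral_swap (f := fun s w => f 0 w * PP s (LL ψ) w) iA, ← integral_sub]
    · congr 1; ext w
      rw [integral_const_mul, ← intervalIntegral.integral_of_le h0.le, PP_ftc hψ h0.le]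
      ring
    · exact ((hf.integrable 0).bdd_mul (c := C1) (f := fun w => PP t ψ w)
        (by
          have := (PP_cont hψ).comp (g := fun x : ℝ × Evec N => PP x.1 ψ x.2)
            (f := fun w => (t, w)) (by fun_prop)
          exact this.aestronglyMeasurable)
        (ae_of_all _ fun w => PP_bdd hC1 t w)).congr (ae_of_all _ fun w => by simp only; ring)
    · exact ((hf.integrable 0).bdd_mul (c := C1) hψ.cont.aestronglyMeasurable
        (ae_of_all _ hC1)).congr (ae_of_all _ fun w => by simp only; ring)
  -- second
  set K : (ℝ × Evec N) × ℝ → ℝ := fun x => f x.1.1 x.1.2 ^ 2 *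
    (if x.1.1 ≤ x.2 then QQ (x.2 - x.1.1) (LL ψ) x.1.2 else 0) with hK
  have iK : Integrable K ((μ.prod volume).prod μ) := by
    have h1 : Integrable (fun x : (ℝ × Evec N) × ℝ => (‖x.1.2‖ * f x.1.1 x.1.2 ^ 2) * (1:ℝ))
        ((μ.prod volume).prod μ) := (hf.prod_int t).mul_prod (integrable_const (1:ℝ))
    refine (h1.const_mul C').mono' ?_ (ae_of_all _ fun x => ?_)
    · have e1 : Measurable (fun x : (ℝ × Evec N) × ℝ => QQ (x.2 - x.1.1) (LL ψ) x.1.2) :=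
        ((QQ_cont hψ.ll).comp (g := fun x : ℝ × Evec N => QQ x.1 (LL ψ) x.2)
          (f := fun x : (ℝ × Evec N) × ℝ => (x.2 - x.1.1, x.1.2)) (by fun_prop)).measurable
      refine Measurable.aestronglyMeasurable ?_
      refine (hf.sq_meas.comp measurable_fst).mul (Measurable.ite ?_ e1 measurable_const)
      exact measurableSet_le (by fun_prop) (by fun_prop)
    · simp only [hK, norm_mul, Real.norm_of_nonneg (sq_nonneg (f x.1.1 x.1.2))]
      split_ifs with h
      · have := QQ_bdd hC' (sub_nonneg.2 h) x.1.2
        rw [Real.norm_eq_abs]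
        nlinarith [mul_le_mul_of_nonneg_left this (sq_nonneg (f x.1.1 x.1.2))]
      · simp; positivity
  have eB : ∫ s in Set.Ioc (0 : ℝ) t, ∫ r in Set.Ioc (0 : ℝ) s, ∫ w, f r w ^ 2 * QQ (s - r) (LL ψ) w =
      (∫ r in Set.Ioc (0 : ℝ) t, ∫ w, f r w ^ 2 * QQ (t - r) ψ w) -
        ∫ r in Set.Ioc (0 : ℝ) t, ∫ w, f r w ^ 2 * fderiv ℝ ψ w w := by
    have e1 : ∫ s in Set.Ioc (0 : ℝ) t, ∫ r in Set.Ioc (0 : ℝ) s, ∫ w, f r w ^ 2 * QQ (s - r) (LL ψ) w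
        = ∫ s in Set.Ioc (0 : ℝ) t, ∫ r in Set.Ioc (0 : ℝ) t, ∫ w, K ((r, w), s) := by
      refine setIntegral_congr_fun measurableSet_Ioc fun s hs => ?_
      have : Set.Ioc 0 s = Set.Ioc 0 t ∩ Set.Iic s := by
        ext r; simp only [Set.mem_inter_iff, Set.mem_Ioc, Set.mem_Iic]
        constructor
        · rintro ⟨a, b⟩; exact ⟨⟨a, b.trans hs.2⟩, b⟩
        · rintro ⟨⟨a, b⟩, c⟩; exact ⟨a, c⟩
      rw [this, ← setIntegral_indicator measurableSet_Iic]
      congr 1; ext r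
      by_cases h : r ≤ s
      · simp [hK, Set.indicator, h]
      · simp [hK, Set.indicator, h]
    rw [e1, fub3 iK]
    have i2 : Integrable (fun x : ℝ × Evec N => f x.1 x.2 ^ 2 * fderiv ℝ ψ x.2 x.2)
        (μ.prod volume) := by
      refine ((hf.prod_int t).const_mul C2).mono'
        (hf.sq_meas.mul (hψ.euler.cont.measurable.comp measurable_snd)).aestronglyMeasurable
        (ae_of_all _ fun x => ?_)
      rw [norm_mul, Real.norm_of_nonneg (sq_nonneg (f x.1 x.2))]
      have := (fderiv ℝ ψ x.2).le_of_opNorm_le (hC2 x.2) x.2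
      nlinarith [mul_le_mul_of_nonneg_left this (sq_nonneg (f x.1 x.2))]
    have i1 : Integrable (fun x : ℝ × Evec N => f x.1 x.2 ^ 2 * QQ (t - x.1) ψ x.2)
        (μ.prod volume) := by
      have q1 : Measurable (fun x : ℝ × Evec N => QQ (t - x.1) ψ x.2) :=
        ((QQ_cont hψ).comp (g := fun x : ℝ × Evec N => QQ x.1 ψ x.2)
          (f := fun x : (ℝ × Evec N) => (t - x.1, x.2)) (by fun_prop)).measurable
      have hae : ∀ᵐ x : ℝ × Evec N ∂(μ.prod volume), x.1 ∈ Set.Ioc 0 t :=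
        Measure.quasiMeasurePreserving_fst.ae (ae_restrict_mem measurableSet_Ioc)
      refine ((hf.prod_int t).const_mul C2).mono' (hf.sq_meas.mul q1).aestronglyMeasurable ?_
      filter_upwards [hae] with x hx
      rw [norm_mul, Real.norm_of_nonneg (sq_nonneg (f x.1 x.2))]
      have := QQ_bdd hC2 (sub_nonneg.2 hx.2) x.2
      rw [Real.norm_eq_abs]
      nlinarith [mul_le_mul_of_nonneg_left this (sq_nonneg (f x.1 x.2))]
    rw [← integral_sub i1.integral_prod_left i2.integral_prod_left]
    refine integral_congr_ae ?_
    filter_upwards [i1.prod_right_ae, i2.prod_right_ae, ae_restrict_mem measurableSet_Ioc]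
      with r h1 h2 h3
    rw [← integral_sub h1 h2]
    congr 1; ext w
    simp only [hK]
    rw [integral_const_mul, inner_int hψ h3]
    ring
  have T1 := tested hf hψ h0 (hm t ⟨h0, ht.2⟩)
  have T2 : ∀ s ∈ Set.Ioc 0 t, ∫ w, f s w * LL ψ w = (∫ w, f 0 w * PP s (LL ψ) w) -
      ∫ r in Set.Ioc (0 : ℝ) s, ∫ w, f r w ^ 2 * QQ (s - r) (LL ψ) w := fun s hs =>
    tested hf hψ.ll hs.1 (hm s ⟨hs.1, hs.2.trans ht.2⟩)
  have i3 : Integrable (fun s => ∫ w, f s w * LL ψ w) μ := by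
    have : Integrable (fun x : ℝ × Evec N => f x.1 x.2 * LL ψ x.2) (μ.prod volume) := by
      have q1 : Measurable (fun x : ℝ × Evec N => LL ψ x.2) :=
        hψ.ll.cont.measurable.comp measurable_snd
      have q2 := (hf.prod_int1 t).bdd_mul (c := C) (f := fun x : ℝ × Evec N => LL ψ x.2)
        q1.aestronglyMeasurable (ae_of_all _ fun x => hC x.2)
      simpa only [mul_comm] using q2
    exact this.integral_prod_left
  have i4 : Integrable (fun s => ∫ w, f s w ^ 2 * fderiv ℝ ψ w w) μ := by
    have : Integrable (fun x : ℝ × Evec N => f x.1 x.2 ^ 2 * fderiv ℝ ψ x.2 x.2)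
        (μ.prod volume) := by
      refine ((hf.prod_int t).const_mul C2).mono'
        (hf.sq_meas.mul (hψ.euler.cont.measurable.comp measurable_snd)).aestronglyMeasurable
        (ae_of_all _ fun x => ?_)
      rw [norm_mul, Real.norm_of_nonneg (sq_nonneg (f x.1 x.2))]
      have := (fderiv ℝ ψ x.2).le_of_opNorm_le (hC2 x.2) x.2
      nlinarith [mul_le_mul_of_nonneg_left this (sq_nonneg (f x.1 x.2))]
    exact this.integral_prod_left
  have iR : Integrable (fun s => ∫ w, f 0 w * PP s (LL ψ) w) μ := iA.integral_prod_left
  have e5 : ∫ s in Set.Ioc (0 : ℝ) t, ∫ w, f s w * LL ψ w =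
      (∫ s in Set.Ioc (0 : ℝ) t, ∫ w, f 0 w * PP s (LL ψ) w) -
      ∫ s in Set.Ioc (0 : ℝ) t, ∫ r in Set.Ioc (0 : ℝ) s, ∫ w, f r w ^ 2 * QQ (s - r) (LL ψ) w := by
    have i5 : Integrable (fun s => ∫ r in Set.Ioc (0 : ℝ) s, ∫ w, f r w ^ 2 * QQ (s - r) (LL ψ) w) μ := by
      refine (iR.sub i3).congr ?_
      filter_upwards [ae_restrict_mem measurableSet_Ioc] with s hs
      simp only [Pi.sub_apply]
      rw [T2 s hs]; ring
    rw [← integral_sub iR i5]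
    exact setIntegral_congr_fun measurableSet_Ioc fun s hs => T2 s hs
  rw [integral_sub i3 i4, e5, eA, eB, T1]
  ring

end

def be (ε x : ℝ) : ℝ := (√(x ^ 2 + ε ^ 2) + x) / 2
def be1 (ε x : ℝ) : ℝ := (x / √(x ^ 2 + ε ^ 2) + 1) / 2
def be2 (ε x : ℝ) : ℝ := ε ^ 2 / (2 * √(x ^ 2 + ε ^ 2) ^ 3)

section
variable {ε : ℝ}

lemma q_pos (hε : 0 < ε) (x : ℝ) : 0 < √(x ^ 2 + ε ^ 2) := Real.sqrt_pos.2 (by positivity)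

lemma q_sq (hε : 0 < ε) (x : ℝ) : √(x ^ 2 + ε ^ 2) ^ 2 = x ^ 2 + ε ^ 2 :=
  Real.sq_sqrt (by positivity)

lemma q_ge_eps (hε : 0 < ε) (x : ℝ) : ε ≤ √(x ^ 2 + ε ^ 2) := by
  have := q_pos hε x; have := q_sq hε x; nlinarith [sq_nonneg x]

lemma q_ge_abs (hε : 0 < ε) (x : ℝ) : |x| ≤ √(x ^ 2 + ε ^ 2) := by
  have h1 := q_pos hε x; have h2 := q_sq hε x
  apply abs_le_of_sq_le_sq (by nlinarith) h1.le

lemma q_le (hε : 0 < ε) (x : ℝ) : √(x ^ 2 + ε ^ 2) ≤ |x| + ε := by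
  rw [Real.sqrt_le_left (by positivity)]
  nlinarith [sq_abs x, abs_nonneg x]

lemma q_deriv (hε : 0 < ε) (x : ℝ) : HasDerivAt (fun x => √(x ^ 2 + ε ^ 2))
    (x / √(x ^ 2 + ε ^ 2)) x := by
  have h := (((hasDerivAt_id x).pow 2).add_const (ε ^ 2)).sqrt
    (show (id x) ^ 2 + ε ^ 2 ≠ 0 by simp; positivity)
  refine h.congr_deriv ?_
  have := q_pos hε x
  simp
  field_simp

lemma be_deriv (hε : 0 < ε) (x : ℝ) : HasDerivAt (be ε) (be1 ε x) x :=
  ((q_deriv hε x).add (hasDerivAt_id x)).div_const 2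

lemma be1_deriv (hε : 0 < ε) (x : ℝ) : HasDerivAt (be1 ε) (be2 ε x) x := by
  have h1 := q_pos hε x
  refine ((((hasDerivAt_id x).div (q_deriv hε x) h1.ne').add_const 1).div_const 2).congr_deriv ?_
  have h2 := q_sq hε x
  unfold be2
  simp only [id]
  set q := √(x ^ 2 + ε ^ 2)
  field_simp
  linarith

lemma be1_contDiff (hε : 0 < ε) : ContDiff ℝ ∞ (be1 ε) := by
  have h : ContDiff ℝ ∞ (fun x : ℝ => √(x ^ 2 + ε ^ 2)) :=
    ContDiff.sqrt (by fun_prop) (fun x => by positivity)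
  exact ((contDiff_id.div h (fun x => (q_pos hε x).ne')).add contDiff_const).div_const 2

lemma be_contDiff (hε : 0 < ε) : ContDiff ℝ ∞ (be ε) := by
  have h : ContDiff ℝ ∞ (fun x : ℝ => √(x ^ 2 + ε ^ 2)) :=
    ContDiff.sqrt (by fun_prop) (fun x => by positivity)
  exact (h.add contDiff_id).div_const 2

lemma be2_cont (hε : 0 < ε) : Continuous (be2 ε) := by
  unfold be2
  refine continuous_const.div (by fun_prop) fun x => ?_
  have := q_pos hε x
  positivity

lemma be2_nonneg (x : ℝ) : 0 ≤ be2 ε x := by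
  unfold be2; positivity

lemma be2_le (hε : 0 < ε) (x : ℝ) : be2 ε x ≤ 1 / ε := by
  unfold be2
  have h1 := q_pos hε x
  have h2 := q_ge_eps hε x
  rw [div_le_div_iff₀ (by positivity) hε]
  have : ε ^ 3 ≤ √(x ^ 2 + ε ^ 2) ^ 3 := by gcongr
  nlinarith [pow_pos hε 3]

lemma be2_sq (hε : 0 < ε) (x : ℝ) : x ^ 2 * be2 ε x ≤ ε := by
  unfold be2
  have h1 := q_pos hε x
  have h2 := q_ge_eps hε x
  have h3 := q_sq hε x
  rw [mul_div_assoc', div_le_iff₀ (by positivity)]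
  set q := √(x ^ 2 + ε ^ 2)
  have : q ^ 3 = (x ^ 2 + ε ^ 2) * q := by rw [← h3]; ring
  rw [this]
  have h4 : x ^ 2 * ε ≤ (x ^ 2 + ε ^ 2) * q :=
    mul_le_mul (by nlinarith) h2 hε.le (by positivity)
  nlinarith [mul_le_mul_of_nonneg_left h4 hε.le, mul_nonneg hε.le (sq_nonneg x), mul_nonneg (mul_nonneg hε.le (sq_nonneg x)) hε.le]

lemma be1_abs (hε : 0 < ε) (x : ℝ) : |be1 ε x| ≤ 1 := by
  have h1 := q_pos hε x
  have h2 := abs_le.1 (q_ge_abs hε x)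
  have h3 : x / √(x ^ 2 + ε ^ 2) ≤ 1 := by rw [div_le_one h1]; exact h2.2
  have h4 : -1 ≤ x / √(x ^ 2 + ε ^ 2) := by rw [le_div_iff₀ h1]; linarith [h2.1]
  unfold be1
  rw [abs_le]; constructor <;> linarith

lemma be_ge (hε : 0 < ε) (x : ℝ) : max x 0 ≤ be ε x := by
  have h2 := abs_le.1 (q_ge_abs hε x)
  unfold be
  rw [max_le_iff]; constructor <;> linarith [h2.1, h2.2]

lemma be_nonneg (hε : 0 < ε) (x : ℝ) : 0 ≤ be ε x := (le_max_right _ _).trans (be_ge hε x)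

lemma be_le (hε : 0 < ε) (x : ℝ) : be ε x ≤ |x| + ε := by
  have := q_le hε x
  unfold be
  linarith [le_abs_self x]

lemma be_le_neg (hε : 0 < ε) {x : ℝ} (hx : x ≤ 0) : be ε x ≤ ε := by
  have := q_le hε x
  rw [abs_of_nonpos hx] at this
  unfold be
  linarith

end

section
variable {N : ℕ} {φ : Evec N → ℝ} {ε : ℝ}

lemma spatial (hε : 0 < ε) (hφ : Tst φ) (hφ0 : ∀ y, 0 ≤ φ y) {u : Evec N → ℝ}
    {J : Fin N → Evec N → ℝ} (hu : ContDiff ℝ ∞ u) (hJ : ∀ i, ContDiff ℝ ∞ (J i)) :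
    ∫ y, φ y * be1 ε (u y) * ∑ i, (DD (ee i) (DD (ee i) u) y + DD (ee i) (J i) y) ≤
    ∫ y, (Lap φ y * be ε (u y) + ∑ i, (φ y * be2 ε (u y) * J i y ^ 2
      - DD (ee i) φ y * be1 ε (u y) * J i y)) := by
  have tst : ∀ {a b : Evec N → ℝ}, Tst a → Continuous b → Integrable (fun y => a y * b y) := by
    intro a b ha hb
    exact (ha.cont.mul hb).integrable_of_hasCompactSupport ha.2.mul_right
  have lin3 : ∀ {a b c : Evec N → ℝ}, Integrable a → Integrable b → Integrable c →
      ∫ y, (a y + b y + c y) = (∫ y, a y) + (∫ y, b y) + ∫ y, c y := by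
    intro a b c ha hb hc
    have h1 : Integrable (fun y => a y + b y) := ha.add hb
    rw [integral_add h1 hc, integral_add ha hb]
  have cb := (be_contDiff hε).continuous
  have cb1 := (be1_contDiff hε).continuous
  have cb2 := be2_cont hε
  have cu := hu.continuous
  have cJ := fun i => (hJ i).continuous
  have cdu := fun i => (hu.dd (ee i)).continuous
  have cddu := fun i => ((hu.dd (ee i)).dd (ee i)).continuous
  have cdJ := fun i => ((hJ i).dd (ee i)).continuous
  have hb1u : ContDiff ℝ ∞ (fun y => be1 ε (u y)) := (be1_contDiff hε).comp hu
  have hbu : ContDiff ℝ ∞ (fun y => be ε (u y)) := (be_contDiff hε).comp hu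
  have hd1 : ∀ i y, DD (ee i) (fun y => be ε (u y)) y = be1 ε (u y) * DD (ee i) u y := by
    intro i y
    have := (be_deriv hε (u y)).comp_hasFDerivAt y (hu.differentiable (by simp) y).hasFDerivAt
    unfold DD
    rw [show (fun y => be ε (u y)) = be ε ∘ u from rfl, this.fderiv]
    simp
  have hd2 : ∀ i y, DD (ee i) (fun y => φ y * be1 ε (u y)) y =
      DD (ee i) φ y * be1 ε (u y) + φ y * be2 ε (u y) * DD (ee i) u y := by
    intro i y
    have := (be1_deriv hε (u y)).comp_hasFDerivAt y (hu.differentiable (by simp) y).hasFDerivAt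
    have h2 := (hφ.diff y).hasFDerivAt.mul this
    unfold DD
    rw [show (fun y => φ y * be1 ε (u y)) = φ * (be1 ε ∘ u) from rfl, h2.fderiv]
    simp
    ring
  have hφb := hφ.mul hb1u
  -- ibp for each i
  have e1 : ∀ i, ∫ y, φ y * be1 ε (u y) * (DD (ee i) (DD (ee i) u) y + DD (ee i) (J i) y) =
      - ∫ y, (DD (ee i) φ y * be1 ε (u y) + φ y * be2 ε (u y) * DD (ee i) u y) *
        (DD (ee i) u y + J i y) := by
    intro i
    have hg : ContDiff ℝ ∞ (fun y => DD (ee i) u y + J i y) := (hu.dd (ee i)).add (hJ i)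
    have h := ibp (hg.of_le (by simp)) (hφb.1.of_le (by simp)) hφb.2 (ee i)
    have h1 : ∀ y, fderiv ℝ (fun y => DD (ee i) u y + J i y) y (ee i) =
        DD (ee i) (DD (ee i) u) y + DD (ee i) (J i) y := by
      intro y
      rw [fderiv_fun_add ((hu.dd (ee i)).differentiable (by simp) y)
        ((hJ i).differentiable (by simp) y)]
      rfl
    simp only [h1] at h
    have h2 : ∀ y, fderiv ℝ (fun y => φ y * be1 ε (u y)) y (ee i) = _ := hd2 i
    simp only [h2] at h
    have h3 : ∫ y, φ y * be1 ε (u y) * (DD (ee i) (DD (ee i) u) y + DD (ee i) (J i) y) =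
      ∫ y, (DD (ee i) (DD (ee i) u) y + DD (ee i) (J i) y) * (φ y * be1 ε (u y)) := by
      congr 1; ext y; ring
    have h4 : ∫ y, (DD (ee i) φ y * be1 ε (u y) + φ y * be2 ε (u y) * DD (ee i) u y) *
        (DD (ee i) u y + J i y) = ∫ y, (DD (ee i) u y + J i y) *
          (DD (ee i) φ y * be1 ε (u y) + φ y * be2 ε (u y) * DD (ee i) u y) := by
      congr 1; ext y; ring
    rw [h3, h4, h]; ring
  have e2 : ∀ i, ∫ y, DD (ee i) φ y * (be1 ε (u y) * DD (ee i) u y) =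
      - ∫ y, DD (ee i) (DD (ee i) φ) y * be ε (u y) := by
    intro i
    have h := ibp (hbu.of_le (by simp)) ((hφ.dd (ee i)).1.of_le (by simp)) (hφ.dd (ee i)).2 (ee i)
    have h2 : ∀ y, fderiv ℝ (fun y => be ε (u y)) y (ee i) = _ := hd1 i
    simp only [h2] at h
    have h3 : ∫ y, DD (ee i) φ y * (be1 ε (u y) * DD (ee i) u y) =
      ∫ y, (be1 ε (u y) * DD (ee i) u y) * DD (ee i) φ y := by congr 1; ext y; ring
    have h4 : ∫ y, DD (ee i) (DD (ee i) φ) y * be ε (u y) =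
      ∫ y, be ε (u y) * fderiv ℝ (DD (ee i) φ) y (ee i) := by
        congr 1; ext y; rw [mul_comm]; rfl
    rw [h3, h4, h]; ring
  have e3 : ∀ i, ∫ y, φ y * be1 ε (u y) * (DD (ee i) (DD (ee i) u) y + DD (ee i) (J i) y) ≤
      ∫ y, (DD (ee i) (DD (ee i) φ) y * be ε (u y) + (φ y * be2 ε (u y) * J i y ^ 2
      - DD (ee i) φ y * be1 ε (u y) * J i y)) := by
    intro i
    have cui := cdu i
    have cJi := cJ i
    have i1 : Integrable (fun y => DD (ee i) φ y * (be1 ε (u y) * DD (ee i) u y)) :=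
      tst (hφ.dd _) (by fun_prop)
    have i2 : Integrable (fun y => DD (ee i) (DD (ee i) φ) y * be ε (u y)) :=
      tst ((hφ.dd _).dd _) (by fun_prop)
    have i3 : Integrable (fun y => φ y * (be2 ε (u y) * (DD (ee i) u y * (DD (ee i) u y + J i y)))) :=
      tst hφ (by fun_prop)
    have i4 : Integrable (fun y => DD (ee i) φ y * (be1 ε (u y) * J i y)) :=
      tst (hφ.dd _) (by fun_prop)
    have i5 : Integrable (fun y => φ y * (be2 ε (u y) * J i y ^ 2)) :=
      tst hφ (by fun_prop)
    have l1 : - ∫ y, (DD (ee i) φ y * be1 ε (u y) + φ y * be2 ε (u y) * DD (ee i) u y) *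
        (DD (ee i) u y + J i y) = - (∫ y, DD (ee i) φ y * (be1 ε (u y) * DD (ee i) u y))
        - (∫ y, DD (ee i) φ y * (be1 ε (u y) * J i y)) -
        ∫ y, φ y * (be2 ε (u y) * (DD (ee i) u y * (DD (ee i) u y + J i y))) := by
      have h := lin3 i1 i4 i3
      rw [← neg_add', ← neg_add', ← h]
      congr 2; ext y; ring
    have l2 : ∫ y, (DD (ee i) (DD (ee i) φ) y * be ε (u y) + (φ y * be2 ε (u y) * J i y ^ 2
      - DD (ee i) φ y * be1 ε (u y) * J i y)) = (∫ y, DD (ee i) (DD (ee i) φ) y * be ε (u y)) +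
      (∫ y, φ y * (be2 ε (u y) * J i y ^ 2)) - (∫ y, DD (ee i) φ y * (be1 ε (u y) * J i y)) := by
      have h := lin3 i2 i5 i4.neg
      simp only [Pi.neg_apply, integral_neg] at h
      rw [sub_eq_add_neg, ← h]
      congr 1; ext y; ring
    have l3 : - ∫ y, φ y * (be2 ε (u y) * (DD (ee i) u y * (DD (ee i) u y + J i y))) ≤
        ∫ y, φ y * (be2 ε (u y) * J i y ^ 2) := by
      rw [← integral_neg]
      refine integral_mono i3.neg i5 fun y => ?_
      have h1 := mul_nonneg (hφ0 y) (be2_nonneg (ε := ε) (u y))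
      have h2 : 0 ≤ DD (ee i) u y * (DD (ee i) u y + J i y) + J i y ^ 2 := by
        nlinarith [sq_nonneg (DD (ee i) u y + J i y), sq_nonneg (DD (ee i) u y), sq_nonneg (J i y)]
      have h3 := mul_nonneg h1 h2
      simp only
      nlinarith
    rw [e1 i, l1, e2 i, l2]
    linarith
  have i6 : ∀ i, Integrable (fun y => φ y * be1 ε (u y) *
      (DD (ee i) (DD (ee i) u) y + DD (ee i) (J i) y)) := fun i =>
    tst hφb ((cddu i).add (cdJ i))
  have i7 : ∀ i, Integrable (fun y => DD (ee i) (DD (ee i) φ) y * be ε (u y) + (φ y * be2 ε (u y) * J i y ^ 2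
      - DD (ee i) φ y * be1 ε (u y) * J i y)) := by
    intro i
    have cJi := cJ i
    have i2 : Integrable (fun y => DD (ee i) (DD (ee i) φ) y * be ε (u y)) :=
      tst ((hφ.dd _).dd _) (by fun_prop)
    have i4 : Integrable (fun y => DD (ee i) φ y * (be1 ε (u y) * J i y)) :=
      tst (hφ.dd _) (by fun_prop)
    have i5 : Integrable (fun y => φ y * (be2 ε (u y) * J i y ^ 2)) :=
      tst hφ (by fun_prop)
    refine (i2.add (i5.sub i4)).congr (ae_of_all _ fun y => ?_)
    simp only [Pi.add_apply, Pi.sub_apply]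
    ring
  have e4 : ∀ y, Lap φ y * be ε (u y) + ∑ i, (φ y * be2 ε (u y) * J i y ^ 2
      - DD (ee i) φ y * be1 ε (u y) * J i y) = ∑ i, (DD (ee i) (DD (ee i) φ) y * be ε (u y) +
      (φ y * be2 ε (u y) * J i y ^ 2 - DD (ee i) φ y * be1 ε (u y) * J i y)) := by
    intro y
    rw [Finset.sum_add_distrib, ← Finset.sum_mul]
    rfl
  simp only [e4, Finset.mul_sum]
  rw [integral_finsetSum _ fun i _ => i6 i, integral_finsetSum _ fun i _ => i7 i]
  exact Finset.sum_le_sum fun i _ => e3 i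

end

def Cv {N : ℕ} (a φ : Evec N → ℝ) (y : Evec N) : ℝ := ∫ w, a w * φ (y - w)

section
variable {N : ℕ} {a φ : Evec N → ℝ}

lemma Cv_eq : Cv a φ = convolution a φ (ContinuousLinearMap.mul ℝ ℝ) volume := by
  ext y; simp [Cv, convolution]

lemma Cv_contDiff (ha : Integrable a) (hφ : Tst φ) : ContDiff ℝ ∞ (Cv a φ) := by
  rw [Cv_eq]
  exact hφ.2.contDiff_convolution_right _ ha.locallyIntegrable hφ.1

lemma Tst.refl (hφ : Tst φ) (y : Evec N) : Tst (fun w => φ (y - w)) :=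
  ⟨hφ.1.comp (contDiff_const.sub contDiff_id), hφ.2.comp_homeomorph (Homeomorph.subLeft y)⟩

lemma Cv_integrable (ha : Integrable a) (hφ : Tst φ) (y : Evec N) :
    Integrable (fun w => a w * φ (y - w)) := by
  obtain ⟨C, hC0, hC⟩ := hφ.bdd
  have := ha.bdd_mul (c := C) (f := fun w => φ (y - w)) (hφ.refl y).cont.aestronglyMeasurable
    (ae_of_all _ fun w => hC _)
  simpa only [mul_comm] using this

lemma Cv_dd (ha : Integrable a) (hφ : Tst φ) (u : Evec N) : DD u (Cv a φ) = Cv a (DD u φ) := by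
  ext y
  have h := hφ.2.hasFDerivAt_convolution_right (ContinuousLinearMap.mul ℝ ℝ)
    ha.locallyIntegrable (hφ.1.of_le (by simp)) y
  unfold DD
  rw [Cv_eq, h.fderiv]
  unfold convolution Cv
  rw [ContinuousLinearMap.integral_apply]
  · congr 1
  · have h1 : HasCompactSupport (fderiv ℝ φ) := hφ.2.fderiv ℝ
    have h2 : Continuous (fderiv ℝ φ) := hφ.1.continuous_fderiv (by simp)
    exact h1.convolutionExists_right _ ha.locallyIntegrable h2 y

lemma Cv_bdd {C : ℝ} (ha : Integrable a) (_hφ : Tst φ) (hC : ∀ v, |φ v| ≤ C) (y : Evec N) :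
    |Cv a φ y| ≤ C * ∫ w, |a w| := by
  unfold Cv
  rw [← Real.norm_eq_abs, ← integral_const_mul]
  refine norm_integral_le_of_norm_le (ha.abs.const_mul C) (ae_of_all _ fun w => ?_)
  rw [norm_mul, mul_comm]
  exact mul_le_mul_of_nonneg_right (hC _) (norm_nonneg _)

lemma Cv_meas {a : ℝ → Evec N → ℝ} (ha : Measurable (Function.uncurry a)) (hφ : Continuous φ) :
    Measurable (fun x : ℝ × Evec N => Cv (a x.1) φ x.2) := by
  unfold Cv
  have h1 : Measurable (fun x : (ℝ × Evec N) × Evec N => a x.1.1 x.2) :=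
    ha.comp (g := Function.uncurry a) (f := fun x : (ℝ × Evec N) × Evec N => (x.1.1, x.2))
      (by fun_prop)
  have h2 : Measurable (fun x : (ℝ × Evec N) × Evec N => φ (x.1.2 - x.2)) :=
    hφ.measurable.comp (by fun_prop)
  exact (h1.mul h2).stronglyMeasurable.integral_prod_right.measurable

lemma refl_fderiv (hφ : Tst φ) (y w u : Evec N) :
    fderiv ℝ (fun w => φ (y - w)) w u = - DD u φ (y - w) := by
  have h1 := (hφ.diff (y - w)).hasFDerivAt.comp w ((hasFDerivAt_id w).const_sub y)
  rw [show (fun w => φ (y - w)) = φ ∘ (HSub.hSub y) from rfl, h1.fderiv]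
  simp [DD]

lemma refl_lap (hφ : Tst φ) (y w : Evec N) : Lap (fun w => φ (y - w)) w = Lap φ (y - w) := by
  unfold Lap
  refine Finset.sum_congr rfl fun i _ => ?_
  have : DD (ee i) (fun w => φ (y - w)) = fun w => - DD (ee i) φ (y - w) := by
    ext w; exact refl_fderiv hφ y w _
  rw [this]
  unfold DD
  rw [fderiv_fun_neg]
  have := refl_fderiv (hφ.dd (ee i)) y w (ee i)
  unfold DD at this
  simp [this]

lemma test_cont {a : ℝ → Evec N → ℝ} (ha : ∀ s, Integrable (a s))
    (hc : ∀ s₀, Tendsto (fun s => ∫ w, |a s w - a s₀ w|) (𝓝 s₀) (𝓝 0))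
    {χ : Evec N → ℝ} (hχ : Tst χ) : Continuous (fun s => ∫ w, a s w * χ w) := by
  obtain ⟨C, hC0, hC⟩ := hχ.bdd
  have hi : ∀ s, Integrable (fun w => a s w * χ w) := fun s => by
    have := (ha s).bdd_mul (c := C) (f := χ) hχ.cont.aestronglyMeasurable (ae_of_all _ hC)
    simpa only [mul_comm] using this
  rw [continuous_iff_continuousAt]
  intro s₀
  unfold ContinuousAt
  rw [tendsto_iff_norm_sub_tendsto_zero]
  refine squeeze_zero (fun _ => norm_nonneg _) (g := fun s => C * ∫ w, |a s w - a s₀ w|)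
    (fun s => ?_) (by simpa using (hc s₀).const_mul C)
  rw [← integral_sub (hi s) (hi s₀), ← integral_const_mul]
  refine norm_integral_le_of_norm_le (((ha s).sub (ha s₀)).abs.const_mul C)
    (ae_of_all _ fun w => ?_)
  rw [← sub_mul, norm_mul, mul_comm]
  exact mul_le_mul_of_nonneg_right (hC _) (norm_nonneg _)

end

structure Pr (N : ℕ) (M T : ℝ) (h k : ℝ → Evec N → ℝ) : Prop where
  mh : Measurable (Function.uncurry h)
  msk : Measurable (Function.uncurry k)
  hb : ∀ s w, |h s w| ≤ M
  kb : ∀ s w, |k s w| ≤ M * |h s w|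
  int : ∀ s, Integrable (fun w => (1 + ‖w‖) * |h s w|)
  l1 : ∀ s, ∫ w, (1 + ‖w‖) * |h s w| ≤ M
  ch : ∀ s₀, Tendsto (fun s => ∫ w, |h s w - h s₀ w|) (𝓝 s₀) (𝓝 0)
  ck : ∀ s₀, Tendsto (fun s => ∫ w, |k s w - k s₀ w|) (𝓝 s₀) (𝓝 0)
  wk : ∀ ψ, Tst ψ → ∀ t ∈ Set.Icc 0 T, ∫ v, h t v * ψ v = (∫ v, h 0 v * ψ v) +
      ∫ s in Set.Ioc (0 : ℝ) t, ((∫ w, h s w * Lap ψ w) - ∫ w, k s w * fderiv ℝ ψ w w)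

def RR {N : ℕ} (h k : Evec N → ℝ) (ρ : Evec N → ℝ) (y : Evec N) : ℝ :=
  ∑ i, (DD (ee i) (DD (ee i) (Cv h ρ)) y + DD (ee i) (Cv (fun w => w i * k w) ρ) y)

section
variable {N : ℕ} {M T : ℝ} {h k : ℝ → Evec N → ℝ} {ρ : Evec N → ℝ}

lemma Pr.M0 (H : Pr N M T h k) : 0 ≤ M := (abs_nonneg _).trans (H.hb 0 0)

lemma Pr.mh1 (H : Pr N M T h k) (s : ℝ) : Measurable (h s) :=
  H.mh.comp (measurable_const.prodMk measurable_id)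

lemma Pr.mk1 (H : Pr N M T h k) (s : ℝ) : Measurable (k s) :=
  H.msk.comp (measurable_const.prodMk measurable_id)

lemma Pr.ih (H : Pr N M T h k) (s : ℝ) : Integrable (h s) := by
  refine (H.int s).mono' (H.mh1 s).aestronglyMeasurable (ae_of_all _ fun w => ?_)
  rw [Real.norm_eq_abs]
  nlinarith [norm_nonneg w, abs_nonneg (h s w)]

lemma Pr.ik (H : Pr N M T h k) (s : ℝ) : Integrable (k s) :=
  ((H.ih s).abs.const_mul M).mono' (H.mk1 s).aestronglyMeasurable (ae_of_all _ fun w => H.kb s w)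

lemma Pr.hl1 (H : Pr N M T h k) (s : ℝ) : ∫ w, |h s w| ≤ M := by
  refine (integral_mono (H.ih s).abs (H.int s) fun w => ?_).trans (H.l1 s)
  simp only
  nlinarith [norm_nonneg w, abs_nonneg (h s w)]

lemma Pr.wk_le (H : Pr N M T h k) (s : ℝ) (i : Fin N) (w : Evec N) :
    |w i * k s w| ≤ M * ((1 + ‖w‖) * |h s w|) := by
  rw [abs_mul]
  have h1 : |w i| ≤ ‖w‖ := PiLp.norm_apply_le w i
  have h2 := H.kb s w
  calc _ ≤ (1 + ‖w‖) * (M * |h s w|) := by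
        apply mul_le_mul _ h2 (abs_nonneg _) (by positivity)
        linarith
    _ = _ := by ring

lemma Pr.iwk (H : Pr N M T h k) (s : ℝ) (i : Fin N) : Integrable (fun w => w i * k s w) :=
  ((H.int s).const_mul M).mono'
    ((by fun_prop : Measurable (fun w : Evec N => w i)).mul (H.mk1 s)).aestronglyMeasurable
    (ae_of_all _ fun w => H.wk_le s i w)

lemma Pr.wkl1 (H : Pr N M T h k) (s : ℝ) (i : Fin N) : ∫ w : Evec N, |w i * k s w| ≤ M * M := by
  refine (integral_mono (H.iwk s i).abs ((H.int s).const_mul M) fun w => H.wk_le s i w).trans ?_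
  rw [integral_const_mul]
  exact mul_le_mul_of_nonneg_left (H.l1 s) H.M0

lemma Pr.mwk (H : Pr N M T h k) (i : Fin N) :
    Measurable (Function.uncurry fun (s : ℝ) (w : Evec N) => w i * k s w) := by
  have h1 : Measurable (fun x : ℝ × Evec N => x.2 i) := by fun_prop
  exact h1.mul H.msk

lemma RR_cv (H : Pr N M T h k) (hρ : Tst ρ) (s : ℝ) (y : Evec N) :
    RR (h s) (k s) ρ y = Cv (h s) (Lap ρ) y +
      ∑ i, Cv (fun w => w i * k s w) (DD (ee i) ρ) y := by
  unfold RR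
  rw [Finset.sum_add_distrib]
  congr 1
  · simp only [Cv_dd (H.ih s) hρ, Cv_dd (H.ih s) (hρ.dd _)]
    unfold Cv Lap
    simp only [Finset.mul_sum]
    rw [integral_finsetSum]
    exact fun i _ => Cv_integrable (H.ih s) ((hρ.dd _).dd _) y
  · simp only [Cv_dd (H.iwk s _) hρ]

lemma RR_eq (H : Pr N M T h k) (hρ : Tst ρ) (s : ℝ) (y : Evec N) :
    RR (h s) (k s) ρ y = (∫ w, h s w * Lap (fun w => ρ (y - w)) w) -
      ∫ w, k s w * fderiv ℝ (fun w => ρ (y - w)) w w := by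
  rw [RR_cv H hρ]
  simp only [refl_lap hρ]
  rw [sub_eq_add_neg]
  congr 1
  rw [← integral_neg]
  unfold Cv
  rw [← integral_finsetSum]
  · congr 1; ext w
    rw [fderiv_sum_ee, Finset.mul_sum, ← Finset.sum_neg_distrib]
    refine Finset.sum_congr rfl fun i _ => ?_
    have := refl_fderiv hρ y w (ee i)
    rw [show DD (ee i) (fun w => ρ (y - w)) w = fderiv ℝ (fun w => ρ (y - w)) w (ee i) from rfl, this]
    ring
  · exact fun i _ => Cv_integrable (H.iwk s i) (hρ.dd _) y

lemma RR_cont (H : Pr N M T h k) (hρ : Tst ρ) (y : Evec N) :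
    Continuous (fun s => RR (h s) (k s) ρ y) := by
  simp only [RR_eq H hρ]
  exact (test_cont H.ih H.ch (hρ.refl y).lap).sub (test_cont H.ik H.ck (hρ.refl y).euler)

lemma RR_meas (H : Pr N M T h k) (hρ : Tst ρ) :
    Measurable (fun x : ℝ × Evec N => RR (h x.1) (k x.1) ρ x.2) := by
  simp only [RR_cv H hρ]
  exact (Cv_meas H.mh hρ.lap.cont).add
    (Finset.measurable_sum _ fun i _ => Cv_meas (H.mwk i) (hρ.dd _).cont)

lemma RR_bdd (H : Pr N M T h k) (hρ : Tst ρ) : ∃ C, 0 ≤ C ∧ ∀ s y, |RR (h s) (k s) ρ y| ≤ C := by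
  obtain ⟨C, hC0, hC⟩ := hρ.lap.bdd
  choose D hD0 hD using fun i : Fin N => (hρ.dd (ee i)).bdd
  have := H.M0
  refine ⟨C * M + ∑ i, D i * (M * M), add_nonneg (by positivity) (Finset.sum_nonneg fun i _ => mul_nonneg (hD0 i) (by positivity)), fun s y => ?_⟩
  rw [RR_cv H hρ]
  refine (abs_add_le _ _).trans (add_le_add ?_ ?_)
  · exact (Cv_bdd (H.ih s) hρ.lap hC y).trans (mul_le_mul_of_nonneg_left (H.hl1 s) hC0)
  · refine (Finset.abs_sum_le_sum_abs _ _).trans (Finset.sum_le_sum fun i _ => ?_)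
    exact (Cv_bdd (H.iwk s i) (hρ.dd _) (hD i) y).trans
      (mul_le_mul_of_nonneg_left (H.wkl1 s i) (hD0 i))

lemma u_eq (H : Pr N M T h k) (hρ : Tst ρ) {t : ℝ} (ht : t ∈ Set.Icc 0 T) (y : Evec N) :
    Cv (h t) ρ y = Cv (h 0) ρ y + ∫ s in (0:ℝ)..t, RR (h s) (k s) ρ y := by
  have := H.wk _ (hρ.refl y) t ht
  simp only [RR_eq H hρ]
  rw [intervalIntegral.integral_of_le ht.1]
  exact this

lemma be_ftc (H : Pr N M T h k) (hρ : Tst ρ) {ε : ℝ} (hε : 0 < ε) {t : ℝ} (ht : t ∈ Set.Icc 0 T)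
    (y : Evec N) :
    ∫ s in Set.Ioc 0 t, be1 ε (Cv (h s) ρ y) * RR (h s) (k s) ρ y =
      be ε (Cv (h t) ρ y) - be ε (Cv (h 0) ρ y) := by
  set U : ℝ → ℝ := fun t => Cv (h 0) ρ y + ∫ s in (0:ℝ)..t, RR (h s) (k s) ρ y with hU
  have hR := RR_cont H hρ y
  have hd : ∀ s, HasDerivAt U (RR (h s) (k s) ρ y) s := fun s =>
    (hR.integral_hasStrictDerivAt 0 s).hasDerivAt.const_add _
  have hUc : Continuous U := continuous_iff_continuousAt.2 fun s => (hd s).continuousAt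
  have h1 : ∀ s ∈ Set.Icc 0 t, Cv (h s) ρ y = U s := fun s hs =>
    u_eq H hρ ⟨hs.1, hs.2.trans ht.2⟩ y
  have h2 : ∫ s in (0:ℝ)..t, be1 ε (U s) * RR (h s) (k s) ρ y = be ε (U t) - be ε (U 0) := by
    refine intervalIntegral.integral_eq_sub_of_hasDerivAt (f := fun s => be ε (U s))
      (fun s _ => (be_deriv hε (U s)).comp s (hd s)) ?_
    exact (((be1_contDiff hε).continuous.comp hUc).mul hR).intervalIntegrable _ _
  rw [h1 t ⟨ht.1, le_rfl⟩, h1 0 ⟨le_rfl, ht.1⟩, ← h2, intervalIntegral.integral_of_le ht.1]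
  refine setIntegral_congr_fun measurableSet_Ioc fun s hs => ?_
  rw [h1 s ⟨hs.1.le, hs.2⟩]

end

def GG {N : ℕ} (ε : ℝ) (φ : Evec N → ℝ) (y : Evec N) (u : ℝ) (J : Fin N → ℝ) : ℝ :=
  Lap φ y * be ε u + ∑ i, (φ y * be2 ε u * J i ^ 2 - DD (ee i) φ y * be1 ε u * J i)

def BB {N : ℕ} (ε M : ℝ) (φ : Evec N → ℝ) (y : Evec N) : ℝ :=
  |Lap φ y| * (M + ε) + ∑ i, (|φ y| * (1 / ε * ((‖y‖ + 1) * (M * M)) ^ 2) +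
    |DD (ee i) φ y| * ((‖y‖ + 1) * (M * M)))

structure Moll {N : ℕ} (ρ : Evec N → ℝ) : Prop where
  tst : Tst ρ
  nonneg : ∀ z, 0 ≤ ρ z
  one : ∫ z, ρ z = 1
  supp : ∀ z, 1 < ‖z‖ → ρ z = 0

section
variable {N : ℕ} {M T ε : ℝ} {h k : ℝ → Evec N → ℝ} {ρ φ : Evec N → ℝ}

lemma BB_int (hφ : Tst φ) : Integrable (BB ε M φ) := by
  have tst : ∀ {a b : Evec N → ℝ}, Tst a → Continuous b → Integrable (fun y => |a y| * b y) := by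
    intro a b ha hb
    exact (ha.cont.abs.mul hb).integrable_of_hasCompactSupport (ha.2.norm.mul_right)
  unfold BB
  refine (tst hφ.lap continuous_const).add (integrable_finsetSum _ fun i _ => ?_)
  exact (tst hφ (by fun_prop)).add (tst (hφ.dd _) (by fun_prop))

lemma GG_le (hε : 0 < ε) {u : ℝ} {J : Fin N → ℝ} {y : Evec N} (hu : |u| ≤ M)
    (hJ : ∀ i, |J i| ≤ (‖y‖ + 1) * (M * M)) : |GG ε φ y u J| ≤ BB ε M φ y := by
  unfold GG BB
  refine (abs_add_le _ _).trans (add_le_add ?_ ((Finset.abs_sum_le_sum_abs _ _).trans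
    (Finset.sum_le_sum fun i _ => (abs_sub _ _).trans (add_le_add ?_ ?_))))
  · rw [abs_mul, abs_of_nonneg (be_nonneg hε u)]
    have := be_le hε u
    gcongr
    linarith
  · rw [abs_mul, abs_mul, abs_of_nonneg (be2_nonneg u), abs_pow, mul_assoc]
    have h2 := be2_le hε u
    have h1 := hJ i
    have h3 := be2_nonneg (ε := ε) u
    gcongr
  · rw [abs_mul, abs_mul]
    have h1 := hJ i
    have h2 := be1_abs hε u
    calc _ ≤ |DD (ee i) φ y| * 1 * ((‖y‖ + 1) * (M * M)) := by gcongr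
      _ = _ := by ring

lemma GG_cont (hε : 0 < ε) (y : Evec N) :
    Continuous (fun x : ℝ × (Fin N → ℝ) => GG ε φ y x.1 x.2) := by
  have h0 := (be_contDiff hε).continuous
  have h1 := (be1_contDiff hε).continuous
  have h2 := be2_cont hε
  unfold GG
  fun_prop

lemma GG_int (hε : 0 < ε) (hφ : Tst φ) (t : ℝ) {U : ℝ → Evec N → ℝ} {J : Fin N → ℝ → Evec N → ℝ}
    (mU : Measurable (Function.uncurry U)) (mJ : ∀ i, Measurable (Function.uncurry (J i)))
    (bU : ∀ s y, |U s y| ≤ M) (bJ : ∀ i s y, |J i s y| ≤ (‖y‖ + 1) * (M * M)) :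
    Integrable (fun x : ℝ × Evec N => GG ε φ x.2 (U x.1 x.2) (fun i => J i x.1 x.2))
      ((volume.restrict (Set.Ioc 0 t)).prod volume) := by
  have h0 := (be_contDiff hε).continuous.measurable
  have h1 := (be1_contDiff hε).continuous.measurable
  have h2 := (be2_cont hε).measurable
  have hb : Integrable (fun x : ℝ × Evec N => (1:ℝ) * BB ε M φ x.2)
    ((volume.restrict (Set.Ioc 0 t)).prod volume) := (integrable_const (1:ℝ)).mul_prod (BB_int hφ)
  refine hb.mono' (Measurable.aestronglyMeasurable ?_) (ae_of_all _ fun x => ?_)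
  · unfold GG
    have mφ : Measurable (fun x : ℝ × Evec N => φ x.2) := hφ.cont.measurable.comp measurable_snd
    have mU' : Measurable (fun x : ℝ × Evec N => U x.1 x.2) := mU
    refine ((hφ.lap.cont.measurable.comp measurable_snd).mul (h0.comp mU')).add
      (Finset.measurable_sum _ fun i _ => ?_)
    have mJ' : Measurable (fun x : ℝ × Evec N => J i x.1 x.2) := mJ i
    exact ((mφ.mul (h2.comp mU')).mul (mJ'.pow_const 2)).sub
      ((((hφ.dd (ee i)).cont.measurable.comp measurable_snd).mul (h1.comp mU')).mul mJ')
  · rw [one_mul]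
    exact GG_le hε (bU _ _) fun i => bJ i _ _

lemma Cv_avg (hρ : Moll ρ) {a : Evec N → ℝ} {B : ℝ} {y : Evec N}
    (hB : ∀ w, ‖y - w‖ ≤ 1 → |a w| ≤ B) : |Cv a ρ y| ≤ B := by
  have h1 : ∫ w, B * ρ (y - w) = B := by
    rw [integral_const_mul, integral_sub_left_eq_self ρ volume y, hρ.one, mul_one]
  rw [← h1, ← Real.norm_eq_abs]
  refine norm_integral_le_of_norm_le (((hρ.tst.refl y).integrable).const_mul B)
    (ae_of_all _ fun w => ?_)
  rw [norm_mul, Real.norm_of_nonneg (hρ.nonneg _)]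
  by_cases hw : ‖y - w‖ ≤ 1
  · exact mul_le_mul_of_nonneg_right (hB w hw) (hρ.nonneg _)
  · rw [hρ.supp _ (not_le.1 hw)]; simp

lemma u_bdd (H : Pr N M T h k) (hρ : Moll ρ) (s : ℝ) (y : Evec N) : |Cv (h s) ρ y| ≤ M :=
  Cv_avg hρ fun w _ => H.hb s w

lemma yk_bdd (H : Pr N M T h k) (i : Fin N) (s : ℝ) (w : Evec N) : |w i * k s w| ≤ ‖w‖ * (M * M) := by
  rw [abs_mul]
  have h1 : |w i| ≤ ‖w‖ := PiLp.norm_apply_le w i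
  have h2 : |k s w| ≤ M * M := (H.kb s w).trans (mul_le_mul_of_nonneg_left (H.hb s w) H.M0)
  gcongr

lemma J_bdd (H : Pr N M T h k) (hρ : Moll ρ) (i : Fin N) (s : ℝ) (y : Evec N) :
    |Cv (fun w => w i * k s w) ρ y| ≤ (‖y‖ + 1) * (M * M) := by
  refine Cv_avg hρ fun w hw => (yk_bdd H i s w).trans ?_
  have h0 : 0 ≤ M * M := mul_self_nonneg M
  have : ‖w‖ ≤ ‖y‖ + 1 := by
    have := norm_sub_norm_le w y
    rw [norm_sub_rev] at this
    linarith
  gcongr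

lemma entropy (H : Pr N M T h k) (hρ : Moll ρ) (hε : 0 < ε) (hφ : Tst φ) (hφ0 : ∀ y, 0 ≤ φ y)
    {t : ℝ} (ht : t ∈ Set.Icc 0 T) (h0 : ∀ᵐ w, h 0 w ≤ 0) :
    ∫ y, φ y * be ε (Cv (h t) ρ y) ≤ ε * (∫ y, φ y) + ∫ s in Set.Ioc 0 t,
      ∫ y, GG ε φ y (Cv (h s) ρ y) (fun i => Cv (fun w => w i * k s w) ρ y) := by
  set μ := volume.restrict (Set.Ioc (0:ℝ) t) with hμ
  have cb := (be_contDiff hε).continuous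
  have cb1 := (be1_contDiff hε).continuous
  have cu : ∀ s, ContDiff ℝ ∞ (Cv (h s) ρ) := fun s => Cv_contDiff (H.ih s) hρ.tst
  have iφ : ∀ s, Integrable (fun y => φ y * be ε (Cv (h s) ρ y)) := fun s =>
    (hφ.cont.mul (cb.comp (cu s).continuous)).integrable_of_hasCompactSupport hφ.2.mul_right
  obtain ⟨C, hC0, hC⟩ := RR_bdd H hρ.tst
  have iF : Integrable (fun x : ℝ × Evec N => φ x.2 * be1 ε (Cv (h x.1) ρ x.2) *
      RR (h x.1) (k x.1) ρ x.2) (μ.prod volume) := by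
    have hb : Integrable (fun x : ℝ × Evec N => (C:ℝ) * φ x.2) (μ.prod volume) :=
      (integrable_const (C:ℝ)).mul_prod hφ.integrable
    refine hb.mono' (Measurable.aestronglyMeasurable ?_) (ae_of_all _ fun x => ?_)
    · exact ((hφ.cont.measurable.comp measurable_snd).mul
        (cb1.measurable.comp (Cv_meas H.mh hρ.tst.cont))).mul (RR_meas H hρ.tst)
    · rw [norm_mul, norm_mul, Real.norm_of_nonneg (hφ0 _), Real.norm_eq_abs, Real.norm_eq_abs]
      have a1 := hφ0 x.2
      have a2 := be1_abs hε (Cv (h x.1) ρ x.2)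
      have a3 := hC x.1 x.2
      calc _ ≤ φ x.2 * 1 * C := by gcongr
        _ = _ := by ring
  have iG := GG_int (M := M) hε hφ t (U := fun s y => Cv (h s) ρ y)
    (J := fun i s y => Cv (fun w => w i * k s w) ρ y)
    (Cv_meas H.mh hρ.tst.cont) (fun i => Cv_meas (H.mwk i) hρ.tst.cont)
    (u_bdd H hρ) (J_bdd H hρ)
  have e1 : ∫ s in Set.Ioc 0 t, ∫ y, φ y * be1 ε (Cv (h s) ρ y) * RR (h s) (k s) ρ y =
      (∫ y, φ y * be ε (Cv (h t) ρ y)) - ∫ y, φ y * be ε (Cv (h 0) ρ y) := by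
    rw [integral_integral_swap (f := fun s y => φ y * be1 ε (Cv (h s) ρ y) * RR (h s) (k s) ρ y) iF,
      ← integral_sub (iφ t) (iφ 0)]
    congr 1; ext y
    simp only [mul_assoc]
    rw [integral_const_mul, be_ftc H hρ.tst hε ht]
    ring
  have e2 : ∫ y, φ y * be ε (Cv (h 0) ρ y) ≤ ε * ∫ y, φ y := by
    rw [← integral_const_mul]
    refine integral_mono (iφ 0) (hφ.integrable.const_mul ε) fun y => ?_
    have : Cv (h 0) ρ y ≤ 0 := by
      refine integral_nonpos_of_ae ?_
      filter_upwards [h0] with w hw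
      exact mul_nonpos_of_nonpos_of_nonneg hw (hρ.nonneg _)
    have := be_le_neg hε this
    simp only
    nlinarith [hφ0 y]
  have e3 : ∫ s in Set.Ioc 0 t, ∫ y, φ y * be1 ε (Cv (h s) ρ y) * RR (h s) (k s) ρ y ≤
      ∫ s in Set.Ioc 0 t,
      ∫ y, GG ε φ y (Cv (h s) ρ y) (fun i => Cv (fun w => w i * k s w) ρ y) := by
    refine integral_mono iF.integral_prod_left iG.integral_prod_left fun s => ?_
    exact spatial hε hφ hφ0 (cu s) (J := fun i => Cv (fun w => w i * k s w) ρ)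
      (fun i => Cv_contDiff (H.iwk s i) hρ.tst)
  linarith

end

def bmp (N : ℕ) (n : ℕ) : ContDiffBump (0 : Evec N) where
  rIn := 1 / (2 * ((n:ℝ) + 1))
  rOut := 1 / ((n:ℝ) + 1)
  rIn_pos := by positivity
  rIn_lt_rOut := by
    apply one_div_lt_one_div_of_lt <;> linarith [(Nat.cast_nonneg n : (0:ℝ) ≤ n)]

def chi (N : ℕ) : ContDiffBump (0 : Evec N) where
  rIn := 1
  rOut := 2
  rIn_pos := by norm_num
  rIn_lt_rOut := by norm_num

def rho (N : ℕ) (n : ℕ) : Evec N → ℝ := (bmp N n).normed volume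

section
variable {N : ℕ} {M T ε : ℝ} {h k : ℝ → Evec N → ℝ} {φ : Evec N → ℝ}

lemma rho_moll (n : ℕ) : Moll (rho N n) where
  tst := ⟨(bmp N n).contDiff_normed, (bmp N n).hasCompactSupport_normed⟩
  nonneg := fun z => (bmp N n).nonneg_normed z
  one := (bmp N n).integral_normed
  supp := by
    intro z hz
    by_contra hne
    have : z ∈ Function.support ((bmp N n).normed volume) := hne
    rw [(bmp N n).support_normed_eq] at this
    have h1 : (bmp N n).rOut ≤ 1 := by
      show 1 / ((n:ℝ) + 1) ≤ 1
      rw [div_le_one (by positivity)]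
      linarith [(Nat.cast_nonneg n : (0:ℝ) ≤ n)]
    simp at this
    linarith

lemma rho_tendsto {a : Evec N → ℝ} (ha : Integrable a) :
    ∀ᵐ y, Tendsto (fun n => Cv a (rho N n) y) atTop (𝓝 (a y)) := by
  have := ContDiffBump.ae_convolution_tendsto_right_of_locallyIntegrable (μ := volume)
    (φ := bmp N) (l := atTop) (K := 2) (g := a)
    (by exact tendsto_one_div_add_atTop_nhds_zero_nat)
    (Eventually.of_forall fun n => by
      show 1 / ((n:ℝ) + 1) ≤ 2 * (1 / (2 * ((n:ℝ) + 1)))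
      have : (0:ℝ) < n + 1 := by positivity
      apply le_of_eq; field_simp)
    ha.locallyIntegrable
  filter_upwards [this] with y hy
  refine hy.congr fun n => ?_
  rw [convolution_eq_swap]
  unfold Cv rho
  congr 1; ext w
  simp [mul_comm]

lemma yk_bdd' (H : Pr N M T h k) (i : Fin N) (s : ℝ) (w : Evec N) :
    |w i * k s w| ≤ (‖w‖ + 1) * (M * M) := by
  have := yk_bdd H i s w
  nlinarith [mul_self_nonneg M]

lemma lim1 (H : Pr N M T h k) (hε : 0 < ε) (hφ : Tst φ) (hφ0 : ∀ y, 0 ≤ φ y)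
    {t : ℝ} (ht : t ∈ Set.Icc 0 T) (h0 : ∀ᵐ w, h 0 w ≤ 0) :
    ∫ y, φ y * be ε (h t y) ≤ ε * (∫ y, φ y) + ∫ s in Set.Ioc 0 t,
      ∫ y, GG ε φ y (h s y) (fun i => y i * k s y) := by
  have cb := (be_contDiff hε).continuous
  have hm := fun n => (rho_moll (N := N) n)
  have iG := fun n => GG_int (M := M) hε hφ t (U := fun s y => Cv (h s) (rho N n) y)
    (J := fun i s y => Cv (fun w => w i * k s w) (rho N n) y)
    (Cv_meas H.mh (hm n).tst.cont) (fun i => Cv_meas (H.mwk i) (hm n).tst.cont)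
    (u_bdd H (hm n)) (J_bdd H (hm n))
  have l1 : Tendsto (fun n => ∫ y, φ y * be ε (Cv (h t) (rho N n) y)) atTop
      (𝓝 (∫ y, φ y * be ε (h t y))) := by
    refine tendsto_integral_of_dominated_convergence (fun y => φ y * (M + ε)) (fun n => ?_)
      (hφ.integrable.mul_const _) (fun n => ae_of_all _ fun y => ?_) ?_
    · exact (hφ.cont.mul (cb.comp (Cv_contDiff (H.ih t) (hm n).tst).continuous)).aestronglyMeasurable
    · rw [norm_mul, Real.norm_of_nonneg (hφ0 y), Real.norm_of_nonneg (be_nonneg hε _)]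
      have a1 := be_le hε (Cv (h t) (rho N n) y)
      have a2 := u_bdd H (hm n) t y
      exact mul_le_mul_of_nonneg_left (by linarith) (hφ0 y)
    · filter_upwards [rho_tendsto (H.ih t)] with y hy
      exact ((cb.tendsto _).comp hy).const_mul _
  have l2 : ∀ s, Tendsto (fun n => ∫ y, GG ε φ y (Cv (h s) (rho N n) y)
      (fun i => Cv (fun w => w i * k s w) (rho N n) y)) atTop
      (𝓝 (∫ y, GG ε φ y (h s y) (fun i => y i * k s y))) := by
    intro s
    refine tendsto_integral_of_dominated_convergence (BB ε M φ) (fun n => ?_)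
      (BB_int hφ) (fun n => ae_of_all _ fun y => ?_) ?_
    · have c0 := (Cv_contDiff (H.ih s) (hm n).tst).continuous
      have c1 := fun i => (Cv_contDiff (H.iwk s i) (hm n).tst).continuous
      have c2 := (be1_contDiff hε).continuous
      have c3 := be2_cont hε
      refine Continuous.aestronglyMeasurable ?_
      unfold GG
      refine (hφ.lap.cont.mul (cb.comp c0)).add (continuous_finsetSum _ fun i _ => ?_)
      exact ((hφ.cont.mul (c3.comp c0)).mul ((c1 i).pow 2)).sub
        (((hφ.dd (ee i)).cont.mul (c2.comp c0)).mul (c1 i))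
    · exact GG_le hε (u_bdd H (hm n) s y) fun i => J_bdd H (hm n) i s y
    · filter_upwards [rho_tendsto (H.ih s), ae_all_iff.2 fun i => rho_tendsto (H.iwk s i)]
        with y hy1 hy2
      have hJ : Tendsto (fun n => (fun i => Cv (fun w => w i * k s w) (rho N n) y)) atTop
        (𝓝 (fun i => y i * k s y)) := tendsto_pi_nhds.2 hy2
      have q := (GG_cont (φ := φ) hε y).tendsto (h s y, fun i => y i * k s y)
      exact Tendsto.comp (g := fun x : ℝ × (Fin N → ℝ) => GG ε φ y x.1 x.2)
        (f := fun n => (Cv (h s) (rho N n) y, fun i => Cv (fun w => w i * k s w) (rho N n) y))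
        q (hy1.prodMk_nhds hJ)
  have l3 : Tendsto (fun n => ∫ s in Set.Ioc 0 t, ∫ y, GG ε φ y (Cv (h s) (rho N n) y)
      (fun i => Cv (fun w => w i * k s w) (rho N n) y)) atTop
      (𝓝 (∫ s in Set.Ioc 0 t, ∫ y, GG ε φ y (h s y) (fun i => y i * k s y))) := by
    refine tendsto_integral_of_dominated_convergence (fun _ => ∫ y, BB ε M φ y) (fun n => ?_)
      (integrable_const _) (fun n => ae_of_all _ fun s => ?_) (ae_of_all _ l2)
    · exact (iG n).integral_prod_left.aestronglyMeasurable
    · refine norm_integral_le_of_norm_le (BB_int hφ) (ae_of_all _ fun y => ?_)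
      exact GG_le hε (u_bdd H (hm n) s y) fun i => J_bdd H (hm n) i s y
  exact le_of_tendsto_of_tendsto' l1 (l3.const_add _) fun n =>
    entropy H (hm n) hε hφ hφ0 ht h0

lemma GG_le2 (H : Pr N M T h k) (hε : 0 < ε) (hφ0 : ∀ y, 0 ≤ φ y) (s : ℝ) (y : Evec N) :
    GG ε φ y (h s y) (fun i => y i * k s y) ≤
      |h s y| * (|Lap φ y| + M * |fderiv ℝ φ y y|) + ε * (|Lap φ y| + φ y * (M ^ 2 * ‖y‖ ^ 2)) := by
  have e1 : GG ε φ y (h s y) (fun i => y i * k s y) = Lap φ y * be ε (h s y) +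
      φ y * be2 ε (h s y) * k s y ^ 2 * ‖y‖ ^ 2 - be1 ε (h s y) * k s y * fderiv ℝ φ y y := by
    unfold GG
    rw [Finset.sum_sub_distrib, fderiv_sum_ee, EuclideanSpace.norm_sq_eq, Finset.mul_sum,
      Finset.mul_sum, ← add_sub_assoc]
    congr 1
    · congr 1
      refine Finset.sum_congr rfl fun i _ => ?_
      simp only [Real.norm_eq_abs, sq_abs]; ring
    · refine Finset.sum_congr rfl fun i _ => ?_
      ring
  rw [e1]
  have b0 := be_le hε (h s y)
  have b0' := be_nonneg hε (h s y)
  have b1 := be1_abs hε (h s y)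
  have b2 := be2_sq hε (h s y)
  have b3 := be2_nonneg (ε := ε) (h s y)
  have kb := H.kb s y
  have M0 := H.M0
  have t1 : Lap φ y * be ε (h s y) ≤ |Lap φ y| * (|h s y| + ε) :=
    (mul_le_mul_of_nonneg_right (le_abs_self _) b0').trans
      (mul_le_mul_of_nonneg_left b0 (abs_nonneg _))
  have t2 : φ y * be2 ε (h s y) * k s y ^ 2 * ‖y‖ ^ 2 ≤ φ y * ε * M ^ 2 * ‖y‖ ^ 2 := by
    have k2 : k s y ^ 2 ≤ M ^ 2 * h s y ^ 2 := by
      rw [← sq_abs, ← sq_abs (h s y), ← mul_pow]; gcongr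
    have : be2 ε (h s y) * k s y ^ 2 ≤ ε * M ^ 2 := by
      calc _ ≤ be2 ε (h s y) * (M ^ 2 * h s y ^ 2) := by gcongr
        _ = M ^ 2 * (h s y ^ 2 * be2 ε (h s y)) := by ring
        _ ≤ M ^ 2 * ε := by gcongr
        _ = _ := by ring
    have := mul_le_mul_of_nonneg_left this (mul_nonneg (hφ0 y) (sq_nonneg ‖y‖))
    nlinarith
  have t3 : - (be1 ε (h s y) * k s y * fderiv ℝ φ y y) ≤ M * |h s y| * |fderiv ℝ φ y y| := by
    refine (neg_le_abs _).trans ?_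
    rw [abs_mul, abs_mul]
    calc _ ≤ 1 * (M * |h s y|) * |fderiv ℝ φ y y| := by gcongr
      _ = _ := by ring
  nlinarith

lemma Pr.prod_int (H : Pr N M T h k) (t : ℝ) :
    Integrable (fun x : ℝ × Evec N => |h x.1 x.2|)
      ((volume.restrict (Set.Ioc 0 t)).prod volume) := by
  have hm : Measurable (fun x : ℝ × Evec N => |h x.1 x.2|) := H.mh.abs
  rw [integrable_prod_iff hm.aestronglyMeasurable]
  refine ⟨ae_of_all _ fun s => (H.ih s).abs, ?_⟩
  refine (integrable_const M).mono' ?_ (ae_of_all _ fun s => ?_)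
  · exact hm.norm.stronglyMeasurable.integral_prod_right.aestronglyMeasurable
  · rw [Real.norm_of_nonneg (integral_nonneg fun w => by positivity)]
    simpa using H.hl1 s

lemma lim2 (H : Pr N M T h k) (hφ : Tst φ) (hφ0 : ∀ y, 0 ≤ φ y)
    {t : ℝ} (ht : t ∈ Set.Icc 0 T) (h0 : ∀ᵐ w, h 0 w ≤ 0) :
    ∫ y, φ y * max (h t y) 0 ≤ ∫ x : ℝ × Evec N,
      |h x.1 x.2| * (|Lap φ x.2| + M * |fderiv ℝ φ x.2 x.2|)
      ∂((volume.restrict (Set.Ioc 0 t)).prod volume) := by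
  set μ := volume.restrict (Set.Ioc (0:ℝ) t) with hμ
  have M0 := H.M0
  obtain ⟨C, hC0, hC⟩ := hφ.lap.bdd
  obtain ⟨C', hC0', hC'⟩ := hφ.euler.bdd
  set A := ∫ x : ℝ × Evec N, |h x.1 x.2| * (|Lap φ x.2| + M * |fderiv ℝ φ x.2 x.2|)
      ∂(μ.prod volume) with hA
  set V : Evec N → ℝ := fun y => |Lap φ y| + φ y * (M ^ 2 * ‖y‖ ^ 2) with hV
  have iV : Integrable V := hφ.lap.integrable.abs.add
    ((hφ.cont.mul (by fun_prop)).integrable_of_hasCompactSupport hφ.2.mul_right)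
  have iV2 : Integrable (fun x : ℝ × Evec N => (1:ℝ) * V x.2) (μ.prod volume) :=
    (integrable_const (1:ℝ)).mul_prod iV
  simp only [one_mul] at iV2
  have iW : Integrable (fun x : ℝ × Evec N =>
      |h x.1 x.2| * (|Lap φ x.2| + M * |fderiv ℝ φ x.2 x.2|)) (μ.prod volume) := by
    have mW : Measurable (fun x : ℝ × Evec N => |Lap φ x.2| + M * |fderiv ℝ φ x.2 x.2|) :=
      (hφ.lap.cont.measurable.comp measurable_snd).abs.add
        ((hφ.euler.cont.measurable.comp measurable_snd).abs.const_mul M)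
    have q := (H.prod_int t).bdd_mul (c := C + M * C') mW.aestronglyMeasurable
      (ae_of_all _ fun x => by
        rw [Real.norm_of_nonneg (by positivity)]
        exact add_le_add (hC _) (mul_le_mul_of_nonneg_left (hC' _) M0))
    simpa only [mul_comm] using q
  set D := (∫ y, φ y) + ∫ x : ℝ × Evec N, V x.2 ∂(μ.prod volume) with hD
  have key : ∀ ε > 0, ∫ y, φ y * max (h t y) 0 ≤ A + ε * D := by
    intro ε hε
    have cb := (be_contDiff hε).continuous
    have iG := GG_int (M := M) hε hφ t (U := h) (J := fun i s y => y i * k s y)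
      H.mh H.mwk H.hb (fun i s y => yk_bdd' H i s y)
    have p1 : ∫ y, φ y * max (h t y) 0 ≤ ∫ y, φ y * be ε (h t y) := by
      refine integral_mono_of_nonneg (ae_of_all _ fun y => mul_nonneg (hφ0 y) (le_max_right _ _))
        ?_ (ae_of_all _ fun y => mul_le_mul_of_nonneg_left (be_ge hε _) (hφ0 y))
      refine (hφ.integrable.mul_const (M + ε)).mono'
        (hφ.cont.measurable.mul (cb.measurable.comp (H.mh1 t))).aestronglyMeasurable
        (ae_of_all _ fun y => ?_)
      rw [norm_mul, Real.norm_of_nonneg (hφ0 y), Real.norm_of_nonneg (be_nonneg hε _)]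
      exact mul_le_mul_of_nonneg_left ((be_le hε _).trans (by linarith [H.hb t y])) (hφ0 y)
    have p2 := lim1 H hε hφ hφ0 ht h0
    have p3 : ∫ s in Set.Ioc 0 t, ∫ y, GG ε φ y (h s y) (fun i => y i * k s y) ≤
        A + ε * ∫ x : ℝ × Evec N, V x.2 ∂(μ.prod volume) := by
      rw [← integral_prod _ iG, ← integral_const_mul, hA, ← integral_add iW (iV2.const_mul ε)]
      exact integral_mono iG (iW.add (iV2.const_mul ε)) fun x => GG_le2 H hε hφ0 x.1 x.2
    rw [hD, mul_add]
    linarith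
  refine le_of_forall_pos_le_add fun δ hδ => ?_
  refine (key (δ / (|D| + 1)) (by positivity)).trans ?_
  have : δ / (|D| + 1) * D ≤ δ := by
    rw [div_mul_eq_mul_div, div_le_iff₀ (by positivity)]
    nlinarith [le_abs_self D]
  linarith

def phi (N n : ℕ) (y : Evec N) : ℝ := chi N ((1 / ((n:ℝ) + 1)) • y)

lemma chi_tst : Tst (chi N : Evec N → ℝ) := ⟨(chi N).contDiff, (chi N).hasCompactSupport⟩

lemma scale_fderiv (hφ : Tst φ) (c : ℝ) (y u : Evec N) :
    fderiv ℝ (fun y => φ (c • y)) y u = c * DD u φ (c • y) := by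
  have h1 := (hφ.diff (c • y)).hasFDerivAt.comp y ((hasFDerivAt_id y).const_smul c)
  have h2 : HasFDerivAt (fun y => φ (c • y)) _ y := h1
  rw [h2.fderiv]
  simp [DD]

lemma scale_lap (hφ : Tst φ) (c : ℝ) (y : Evec N) :
    Lap (fun y => φ (c • y)) y = c ^ 2 * Lap φ (c • y) := by
  unfold Lap
  rw [Finset.mul_sum]
  refine Finset.sum_congr rfl fun i _ => ?_
  have : DD (ee i) (fun w => φ (c • w)) = fun w => c * DD (ee i) φ (c • w) := by
    ext w; exact scale_fderiv hφ c w _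
  rw [this]
  have h2 := scale_fderiv (hφ.dd (ee i)) c y (ee i)
  have hd : Differentiable ℝ (fun y => DD (ee i) φ (c • y)) :=
    (hφ.dd (ee i)).diff.comp (differentiable_id.const_smul c)
  have h3 : DD (ee i) (fun w => c * DD (ee i) φ (c • w)) y =
      c * fderiv ℝ (fun y => DD (ee i) φ (c • y)) y (ee i) := by
    unfold DD at hd ⊢
    rw [fderiv_const_mul (hd y)]; simp
  rw [h3, h2]; ring

lemma phi_tst (n : ℕ) : Tst (phi N n) := by
  have hc : (1 / ((n:ℝ) + 1)) ≠ 0 := by positivity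
  refine ⟨chi_tst.1.comp (contDiff_id.const_smul _), ?_⟩
  exact chi_tst.2.comp_homeomorph (Homeomorph.smulOfNeZero _ hc)

theorem Pr.nonpos (H : Pr N M T h k) {t : ℝ} (ht : t ∈ Set.Icc 0 T) (h0 : ∀ᵐ w, h 0 w ≤ 0) :
    ∀ᵐ w, h t w ≤ 0 := by
  set μ := volume.restrict (Set.Ioc (0:ℝ) t) with hμ
  have M0 := H.M0
  obtain ⟨C, hC0, hC⟩ := (chi_tst (N := N)).lap.bdd
  obtain ⟨C', hC0', hC'⟩ := (chi_tst (N := N)).euler.bdd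
  have hcn : ∀ n : ℕ, 0 ≤ 1 / ((n:ℝ) + 1) ∧ 1 / ((n:ℝ) + 1) ≤ 1 := fun n => by
    refine ⟨by positivity, ?_⟩
    rw [div_le_one (by positivity)]
    linarith [(Nat.cast_nonneg n : (0:ℝ) ≤ n)]
  have hc0 : Tendsto (fun n : ℕ => 1 / ((n:ℝ) + 1)) atTop (𝓝 0) :=
    tendsto_one_div_add_atTop_nhds_zero_nat
  have hcy : ∀ y : Evec N, Tendsto (fun n : ℕ => (1 / ((n:ℝ) + 1)) • y) atTop (𝓝 0) := fun y => by
    simpa using hc0.smul_const y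
  have eul : ∀ n y, fderiv ℝ (phi N n) y y =
      fderiv ℝ (chi N) ((1 / ((n:ℝ) + 1)) • y) ((1 / ((n:ℝ) + 1)) • y) := fun n y => by
    have := scale_fderiv (chi_tst (N := N)) (1 / ((n:ℝ) + 1)) y y
    rw [show phi N n = fun y => chi N ((1 / ((n:ℝ) + 1)) • y) from rfl, this, map_smul]
    rfl
  have lapn : ∀ n y, Lap (phi N n) y =
      (1 / ((n:ℝ) + 1)) ^ 2 * Lap (chi N) ((1 / ((n:ℝ) + 1)) • y) := fun n y =>
    scale_lap (chi_tst (N := N)) (1 / ((n:ℝ) + 1)) y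
  have imax : Integrable (fun y => max (h t y) 0) := (H.ih t).pos_part
  have l1 : Tendsto (fun n => ∫ y, phi N n y * max (h t y) 0) atTop
      (𝓝 (∫ y, max (h t y) 0)) := by
    refine tendsto_integral_of_dominated_convergence (fun y => max (h t y) 0) (fun n => ?_)
      imax (fun n => ae_of_all _ fun y => ?_) (ae_of_all _ fun y => ?_)
    · exact (phi_tst n).cont.aestronglyMeasurable.mul imax.1
    · rw [norm_mul, Real.norm_of_nonneg (le_max_right _ _ : (0:ℝ) ≤ max (h t y) 0)]
      refine mul_le_of_le_one_left (le_max_right _ _) ?_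
      unfold phi
      rw [Real.norm_of_nonneg (chi N).nonneg]
      exact (chi N).le_one
    · have h1 := ((chi_tst (N := N)).cont.tendsto 0).comp (hcy y)
      have h2 : (chi N) (0 : Evec N) = 1 := (chi N).one_of_mem_closedBall (by simp [(chi N).rIn_pos.le])
      rw [h2] at h1
      have h3 := h1.mul_const (max (h t y) 0)
      rw [one_mul] at h3
      exact h3
  have l2 : Tendsto (fun n => ∫ x : ℝ × Evec N,
      |h x.1 x.2| * (|Lap (phi N n) x.2| + M * |fderiv ℝ (phi N n) x.2 x.2|) ∂(μ.prod volume)) atTop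
      (𝓝 (∫ x : ℝ × Evec N, (0:ℝ) ∂(μ.prod volume))) := by
    refine tendsto_integral_of_dominated_convergence (fun x => |h x.1 x.2| * (C + M * C'))
      (fun n => ?_) ((H.prod_int t).mul_const _) (fun n => ae_of_all _ fun x => ?_)
      (ae_of_all _ fun x => ?_)
    · have mW : Measurable (fun x : ℝ × Evec N => |Lap (phi N n) x.2| + M * |fderiv ℝ (phi N n) x.2 x.2|) :=
        ((phi_tst n).lap.cont.measurable.comp measurable_snd).abs.add
          (((phi_tst n).euler.cont.measurable.comp measurable_snd).abs.const_mul M)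
      exact (H.mh.abs.mul mW).aestronglyMeasurable
    · rw [Real.norm_of_nonneg (by positivity), lapn, eul, abs_mul]
      have a1 := hC ((1 / ((n:ℝ) + 1)) • x.2)
      have a2 := hC' ((1 / ((n:ℝ) + 1)) • x.2)
      have a3 : |(1 / ((n:ℝ) + 1)) ^ 2| ≤ 1 := by
        rw [abs_of_nonneg (by positivity)]
        exact pow_le_one₀ (hcn n).1 (hcn n).2
      have a4 : |(1 / ((n:ℝ) + 1)) ^ 2| * |Lap (chi N) ((1 / ((n:ℝ) + 1)) • x.2)| ≤ 1 * C := by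
        gcongr
      rw [one_mul] at a4
      gcongr
    · simp only [lapn, eul]
      have q1 := ((chi_tst (N := N)).lap.cont.tendsto 0).comp (hcy x.2)
      have q2 := ((chi_tst (N := N)).euler.cont.tendsto 0).comp (hcy x.2)
      have q3 := (((hc0.pow 2).mul q1).abs.add (q2.abs.const_mul M)).const_mul |h x.1 x.2|
      simpa using q3
  have hle := le_of_tendsto_of_tendsto' l1 l2 fun n =>
    lim2 H (phi_tst n) (fun y => (chi N).nonneg) ht h0
  rw [integral_zero] at hle
  have hz := (integral_eq_zero_iff_of_nonneg (fun y => le_max_right (h t y) 0) imax).1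
    (le_antisymm hle (integral_nonneg fun y => le_max_right _ _))
  filter_upwards [hz] with y hy
  exact (le_max_left _ _).trans hy.le

end

lemma version {N : ℕ} (F : ℝ → Lp ℝ 1 (volume : Measure (Evec N))) (hF : UniformContinuous F) :
    ∃ φ : ℝ → Evec N → ℝ, Measurable (Function.uncurry φ) ∧ ∀ s, φ s =ᵐ[volume] F s := by
  have hd : ∀ n : ℕ, ∃ δ > 0, ∀ a b : ℝ, dist a b < δ → edist (F a) (F b) < (2⁻¹ : ℝ≥0∞) ^ n := by
    intro n
    obtain ⟨δ, h0, h1⟩ := EMetric.uniformContinuous_iff.1 hF ((2⁻¹ : ℝ≥0∞) ^ n)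
      (ENNReal.pow_pos (by simp) n)
    obtain ⟨r, r0, hr⟩ : ∃ r : ℝ, 0 < r ∧ ENNReal.ofReal r ≤ δ := by
      rcases eq_or_ne δ ⊤ with h | h
      · exact ⟨1, one_pos, by simp [h]⟩
      · exact ⟨δ.toReal, ENNReal.toReal_pos h0.ne' h, by simp [h]⟩
    refine ⟨r, r0, fun a b hab => h1 ?_⟩
    refine lt_of_lt_of_le ?_ hr
    rw [edist_dist]
    exact (ENNReal.ofReal_lt_ofReal_iff r0).2 hab
  choose δ δ0 hδ using hd
  let q : ℕ → ℝ → Evec N → ℝ := fun n s w => (F (δ n * (⌊s / δ n⌋ : ℤ)) : Evec N → ℝ) w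
  have mq : ∀ n, Measurable (Function.uncurry (q n)) := by
    intro n
    have m1 : Measurable (fun x : ℤ × Evec N => (F (δ n * (x.1 : ℝ)) : Evec N → ℝ) x.2) :=
      measurable_from_prod_countable_right fun j =>
        (Lp.stronglyMeasurable (F (δ n * (j : ℝ)))).measurable
    have m2 : Measurable (fun x : ℝ × Evec N => (⌊x.1 / δ n⌋, x.2)) :=
      (Int.measurable_floor.comp (measurable_fst.div_const _)).prodMk measurable_snd
    exact m1.comp m2
  refine ⟨fun s w => limsup (fun n => q n s w) atTop, ?_, fun s => ?_⟩
  · exact Measurable.limsup (f := fun n (x : ℝ × Evec N) => q n x.1 x.2) mq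
  · have hs : ∀ n, ∫⁻ w, ‖q n s w - F s w‖ₑ ≤ (2⁻¹ : ℝ≥0∞) ^ n := by
      intro n
      have := (hδ n (δ n * (⌊s / δ n⌋ : ℤ)) s (by
        have a1 := Int.floor_le (s / δ n)
        have a2 := Int.lt_floor_add_one (s / δ n)
        rw [le_div_iff₀ (δ0 n)] at a1
        rw [div_lt_iff₀ (δ0 n)] at a2
        rw [Real.dist_eq, abs_lt]
        constructor <;> nlinarith [δ0 n])).le
      rw [Lp.edist_def, eLpNorm_one_eq_lintegral_enorm] at this
      exact this
    have mm : ∀ n, AEMeasurable (fun w => ‖q n s w - F s w‖ₑ) volume := by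
      intro n
      have a1 : Measurable (q n s) := (mq n).comp measurable_prodMk_left
      exact (a1.sub (Lp.stronglyMeasurable (F s)).measurable).enorm.aemeasurable
    have hfin : ∫⁻ w, ∑' n, ‖q n s w - F s w‖ₑ ≠ ⊤ := by
      rw [lintegral_tsum mm]
      refine ne_top_of_le_ne_top ?_ (ENNReal.tsum_le_tsum hs)
      rw [ENNReal.tsum_geometric]
      simp
    have hmt : AEMeasurable (fun w => ∑' n, ‖q n s w - F s w‖ₑ) volume := AEMeasurable.tsum mm
    have hae := ae_lt_top' hmt hfin
    filter_upwards [hae] with w hw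
    have h1 := ENNReal.tendsto_atTop_zero_of_tsum_ne_top hw.ne
    have h2 : Tendsto (fun n => q n s w) atTop (𝓝 (F s w)) := by
      rw [tendsto_iff_edist_tendsto_0]
      simpa only [edist_eq_enorm_sub] using h1
    exact h2.limsup_eq

section
variable {N : ℕ} {p m T : ℝ} {f₀ : Evec N → ℝ} {f : ℝ → Evec N → ℝ}

lemma ups_bound (h1 : ∀ t ∈ Set.Icc (0 : ℝ) T, MemUpsilon N p m (f t))
    (h2 : ContinuousInUpsilon N p m T f) : ∃ M : ℝ, 0 ≤ M ∧ ∀ t ∈ Set.Icc (0:ℝ) T,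
      eLpNorm (f t) ⊤ volume ≤ ENNReal.ofReal M ∧ wLpNorm N 1 1 (f t) ≤ ENNReal.ofReal M := by
  have hw : ∀ g : Evec N → ℝ, AEStronglyMeasurable g volume →
      AEStronglyMeasurable (fun v => (1 + ‖v‖ ^ (1:ℝ)) * g v) volume := fun g hg => by
    have c : Continuous (fun v : Evec N => 1 + ‖v‖ ^ (1:ℝ)) := by
      simp only [Real.rpow_one]; fun_prop
    exact c.aestronglyMeasurable.mul hg
  suffices H : ∃ M : ℝ≥0∞, M ≠ ⊤ ∧ ∀ t ∈ Set.Icc (0:ℝ) T,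
      eLpNorm (f t) ⊤ volume ≤ M ∧ wLpNorm N 1 1 (f t) ≤ M by
    obtain ⟨M, hM, h⟩ := H
    exact ⟨M.toReal, ENNReal.toReal_nonneg, by rwa [ENNReal.ofReal_toReal hM]⟩
  refine isCompact_Icc.induction_on (p := fun S => ∃ M : ℝ≥0∞, M ≠ ⊤ ∧ ∀ t ∈ S,
      eLpNorm (f t) ⊤ volume ≤ M ∧ wLpNorm N 1 1 (f t) ≤ M) ⟨0, by simp, by simp⟩ ?_ ?_ ?_
  · rintro s t hst ⟨M, hM, h⟩
    exact ⟨M, hM, fun x hx => h x (hst hx)⟩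
  · rintro s t ⟨M, hM, h⟩ ⟨M', hM', h'⟩
    refine ⟨max M M', by simp [hM, hM'], fun x hx => ?_⟩
    rcases hx with hx | hx
    · exact ⟨(h x hx).1.trans (le_max_left _ _), (h x hx).2.trans (le_max_left _ _)⟩
    · exact ⟨(h' x hx).1.trans (le_max_right _ _), (h' x hx).2.trans (le_max_right _ _)⟩
  · intro t₀ ht₀
    obtain ⟨δ, δ0, hδ⟩ := h2 t₀ ht₀ 1 one_pos
    obtain ⟨u1, u2, u3, -⟩ := h1 t₀ ht₀
    refine ⟨Set.Icc 0 T ∩ Metric.ball t₀ δ, inter_mem_nhdsWithin _ (Metric.ball_mem_nhds _ δ0),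
      ENNReal.ofReal 1 + max (eLpNorm (f t₀) ⊤ volume) (wLpNorm N 1 1 (f t₀)), ?_, ?_⟩
    · exact ENNReal.add_ne_top.2 ⟨ENNReal.ofReal_ne_top, (max_lt u2 u3).ne⟩
    · rintro t ⟨ht, htb⟩
      have a := hδ t ht htb
      unfold UpsilonNorm at a
      obtain ⟨a1, a2⟩ := max_lt_iff.1 a
      obtain ⟨a2, -⟩ := max_lt_iff.1 a2
      have v1 := (h1 t ht).1
      constructor
      · have e : f t = (fun v => f t v - f t₀ v) + f t₀ := by ext v; simp
        rw [e]
        refine (eLpNorm_add_le (v1.sub u1) u1 (by simp)).trans ?_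
        exact add_le_add a1.le (le_max_left _ _)
      · unfold wLpNorm at *
        have e : (fun v => (1 + ‖v‖ ^ (1:ℝ)) * f t v) =
          (fun v => (1 + ‖v‖ ^ (1:ℝ)) * (f t v - f t₀ v)) + fun v => (1 + ‖v‖ ^ (1:ℝ)) * f t₀ v := by
          ext v; simp only [Pi.add_apply]; ring
        rw [e]
        refine (eLpNorm_add_le (hw _ (v1.sub u1)) (hw _ u1) (by simp)).trans ?_
        exact add_le_add a2.le (le_max_right _ _)

lemma w_ge (g : Evec N → ℝ) : eLpNorm g 1 volume ≤ wLpNorm N 1 1 g := by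
  unfold wLpNorm
  refine eLpNorm_mono fun v => ?_
  rw [norm_mul, Real.rpow_one, Real.norm_of_nonneg (by positivity : (0:ℝ) ≤ 1 + ‖v‖)]
  nlinarith [norm_nonneg v, norm_nonneg (g v), mul_nonneg (norm_nonneg v) (norm_nonneg (g v))]

lemma good (hT : 0 < T) (hf : IsMildSolution N p m T f₀ f) : ∃ (M : ℝ) (φ : ℝ → Evec N → ℝ),
    Nice N M φ ∧ Mild N T φ ∧ (∀ s ∈ Set.Icc 0 T, φ s =ᵐ[volume] f s) ∧
    ∀ s₀, Tendsto (fun s => ∫ w, |φ s w - φ s₀ w|) (𝓝 s₀) (𝓝 0) := by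
  obtain ⟨h1, h2, h3, h4⟩ := hf
  obtain ⟨M, M0, hM⟩ := ups_bound h1 h2
  have hml : ∀ t : Set.Icc (0:ℝ) T, MemLp (f t) 1 volume := fun t =>
    ⟨(h1 t t.2).1, (w_ge _).trans_lt (h1 t t.2).2.2.1⟩
  let G : Set.Icc (0:ℝ) T → Lp ℝ 1 (volume : Measure (Evec N)) := fun t => (hml t).toLp (f t)
  have hG : Continuous G := by
    rw [Metric.continuous_iff]
    intro t₀ ε ε0
    obtain ⟨δ, δ0, hδ⟩ := h2 t₀ t₀.2 ε ε0
    refine ⟨δ, δ0, fun t ht => ?_⟩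
    have a := hδ t t.2 ht
    have b : edist (G t) (G t₀) < ENNReal.ofReal ε := by
      simp only [G]
      rw [Lp.edist_toLp_toLp]
      refine lt_of_le_of_lt (w_ge _) (lt_of_le_of_lt ?_ a)
      exact (le_max_left _ _).trans (le_max_right _ _)
    rw [edist_dist] at b
    exact (ENNReal.ofReal_lt_ofReal_iff ε0).1 b
  let F : ℝ → Lp ℝ 1 (volume : Measure (Evec N)) := fun s => G (Set.projIcc 0 T hT.le s)
  have hF : UniformContinuous F :=
    (CompactSpace.uniformContinuous_of_continuous hG).comp
      (LipschitzWith.projIcc hT.le).uniformContinuous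
  obtain ⟨ψ, mψ, eψ⟩ := version F hF
  have ef : ∀ s, ψ s =ᵐ[volume] f (Set.projIcc 0 T hT.le s) := fun s =>
    (eψ s).trans (MemLp.coeFn_toLp _)
  let φ : ℝ → Evec N → ℝ := fun s w => max (-M) (min M (ψ s w))
  have ep : ∀ s, φ s =ᵐ[volume] ψ s := fun s => by
    have b := (hM _ (Set.projIcc 0 T hT.le s).2).1
    rw [eLpNorm_exponent_top] at b
    filter_upwards [ef s, ae_le_eLpNormEssSup (f := f (Set.projIcc 0 T hT.le s)) (μ := volume)]
      with w hw1 hw2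
    have c := hw2.trans b
    rw [← hw1, ← ofReal_norm, ENNReal.ofReal_le_ofReal_iff M0, Real.norm_eq_abs, abs_le] at c
    simp only [φ]
    rw [min_eq_right c.2, max_eq_right c.1]
  have mφ : Measurable (Function.uncurry φ) := measurable_const.max (measurable_const.min mψ)
  have efφ : ∀ s, φ s =ᵐ[volume] f (Set.projIcc 0 T hT.le s) := fun s => (ep s).trans (ef s)
  have mφ1 : ∀ s, Measurable (φ s) := fun s => mφ.comp measurable_prodMk_left
  have hwl : ∀ s, ∫⁻ w, ENNReal.ofReal ((1 + ‖w‖) * |φ s w|) ≤ ENNReal.ofReal M := fun s => by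
    have b := (hM _ (Set.projIcc 0 T hT.le s).2).2
    unfold wLpNorm at b
    rw [eLpNorm_one_eq_lintegral_enorm] at b
    refine le_of_eq_of_le (lintegral_congr_ae ?_) b
    filter_upwards [efφ s] with w hw
    rw [← ofReal_norm, norm_mul, Real.rpow_one,
      Real.norm_of_nonneg (by positivity : (0:ℝ) ≤ 1 + ‖w‖), ← hw, Real.norm_eq_abs]
  have mw : ∀ s, Measurable (fun w => (1 + ‖w‖) * |φ s w|) := fun s =>
    (measurable_const.add measurable_norm).mul (mφ1 s).abs
  have hfr : ∀ s ∈ Set.Icc 0 T, φ s =ᵐ[volume] f s := fun s hs => by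
    have := efφ s
    rwa [Set.projIcc_of_mem hT.le hs] at this
  refine ⟨M, φ, ⟨mφ, fun s w => ?_, fun s => ?_, fun s => ?_⟩, ?_, hfr, ?_⟩
  · exact abs_le.2 ⟨le_max_left _ _, max_le (by linarith) (min_le_left _ _)⟩
  · refine ⟨(mw s).aestronglyMeasurable, ?_⟩
    rw [hasFiniteIntegral_iff_ofReal (ae_of_all _ fun w => by positivity)]
    exact (hwl s).trans_lt ENNReal.ofReal_lt_top
  · rw [integral_eq_lintegral_of_nonneg_ae (ae_of_all _ fun w => by positivity)
      (mw s).aestronglyMeasurable]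
    exact ENNReal.toReal_le_of_le_ofReal M0 (hwl s)
  · intro t ht
    filter_upwards [h4 t ht, hfr t ⟨ht.1.le, ht.2⟩] with v hv1 hv2
    rw [hv2, hv1]
    congr 1
    · refine integral_congr_ae ?_
      filter_upwards [h3, hfr 0 ⟨le_rfl, hT.le⟩] with w a b
      rw [b, a]
    · refine setIntegral_congr_fun measurableSet_Ioc fun s hs => ?_
      congr 1
      refine integral_congr_ae ?_
      filter_upwards [hfr s ⟨hs.1.le, hs.2.trans ht.2⟩] with w a
      rw [a, inner_gradient_left]
  · intro s₀
    have a : Tendsto (fun s => dist (F s) (F s₀)) (𝓝 s₀) (𝓝 0) := by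
      have := (hF.continuous.tendsto s₀).dist (tendsto_const_nhds (x := F s₀))
      rwa [dist_self] at this
    refine a.congr fun s => ?_
    rw [dist_eq_norm, L1.norm_eq_integral_norm]
    refine integral_congr_ae ?_
    filter_upwards [Lp.coeFn_sub (F s) (F s₀), ep s, ep s₀, eψ s, eψ s₀] with w a b c d e
    rw [a, b, c, d, e]
    rfl

end

section
variable {N : ℕ} {M T : ℝ} {ψ : Evec N → ℝ} {f g : ℝ → Evec N → ℝ}

lemma Nice.i_bdd (hf : Nice N M f) (s : ℝ) {q : Evec N → ℝ} (hq : Tst q) :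
    Integrable (fun w => f s w * q w) := by
  obtain ⟨C, hC0, hC⟩ := hq.bdd
  have q2 := (hf.integrable s).bdd_mul (c := C) (f := q) hq.cont.aestronglyMeasurable
    (ae_of_all _ hC)
  simpa only [mul_comm] using q2

lemma Nice.sq (hf : Nice N M f) : Nice N (M * M + M) (fun s w => f s w ^ 2) where
  meas := hf.sq_meas
  bdd s w := by
    have := hf.bdd s w
    have h0 := abs_nonneg (f s w)
    rw [abs_pow]; nlinarith [hf.M0]
  int s := by
    refine ((hf.int s).const_mul M).mono' ?_ (ae_of_all _ fun w => ?_)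
    · exact ((measurable_const.add measurable_norm).mul ((hf.meas1 s).pow_const 2).abs).aestronglyMeasurable
    · rw [Real.norm_of_nonneg (by positivity), abs_pow]
      have := hf.bdd s w
      have h0 := abs_nonneg (f s w)
      have h1 : (0:ℝ) ≤ (1 + ‖w‖) * |f s w| := by positivity
      nlinarith
  l1 s := by
    have i1 := (hf.int s).const_mul M
    calc ∫ w, (1 + ‖w‖) * |f s w ^ 2| ≤ ∫ w, M * ((1 + ‖w‖) * |f s w|) := by
          refine integral_mono_of_nonneg (ae_of_all _ fun w => by positivity) i1
            (ae_of_all _ fun w => ?_)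
          simp only [abs_pow]
          have := hf.bdd s w
          have h0 := abs_nonneg (f s w)
          have h1 : (0:ℝ) ≤ (1 + ‖w‖) * |f s w| := by positivity
          nlinarith
      _ = M * ∫ w, (1 + ‖w‖) * |f s w| := integral_const_mul _ _
      _ ≤ M * M + M := by nlinarith [hf.l1 s, hf.M0]

lemma Nice.i_time (hf : Nice N M f) (t : ℝ) {q : Evec N → ℝ} (hq : Tst q) :
    Integrable (fun s => ∫ w, f s w * q w) (volume.restrict (Set.Ioc (0:ℝ) t)) := by
  obtain ⟨C, hC0, hC⟩ := hq.bdd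
  have : Integrable (fun x : ℝ × Evec N => f x.1 x.2 * q x.2)
      ((volume.restrict (Set.Ioc (0:ℝ) t)).prod volume) := by
    have q1 : Measurable (fun x : ℝ × Evec N => q x.2) := hq.cont.measurable.comp measurable_snd
    have q2 := (hf.prod_int1 t).bdd_mul (c := C) (f := fun x : ℝ × Evec N => q x.2)
      q1.aestronglyMeasurable (ae_of_all _ fun x => hC x.2)
    simpa only [mul_comm] using q2
  exact this.integral_prod_left

/-- weak formulation, regrouped -/
lemma weak2 (hf : Nice N M f) (hm : Mild N T f) (hψ : Tst ψ) {t : ℝ} (ht : t ∈ Set.Icc 0 T) :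
    ∫ v, f t v * ψ v = (∫ v, f 0 v * ψ v) + ∫ s in Set.Ioc (0 : ℝ) t,
      ((∫ w, f s w * Lap ψ w) - ((∫ w, f s w * fderiv ℝ ψ w w) +
        ∫ w, f s w ^ 2 * fderiv ℝ ψ w w)) := by
  rw [weak hf hm hψ ht]
  congr 1
  refine setIntegral_congr_fun measurableSet_Ioc fun s hs => ?_
  have e : ∫ w, f s w * LL ψ w = (∫ w, f s w * Lap ψ w) - ∫ w, f s w * fderiv ℝ ψ w w := by
    rw [← integral_sub (hf.i_bdd s hψ.lap) (hf.i_bdd s hψ.euler)]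
    congr 1; ext w; unfold LL; ring
  simp only [e]; ring

lemma mkPr {Mf Mg : ℝ} (hf : Nice N Mf f) (hg : Nice N Mg g) (mf : Mild N T f) (mg : Mild N T g)
    (cf : ∀ s₀, Tendsto (fun s => ∫ w, |f s w - f s₀ w|) (𝓝 s₀) (𝓝 0))
    (cg : ∀ s₀, Tendsto (fun s => ∫ w, |g s w - g s₀ w|) (𝓝 s₀) (𝓝 0)) :
    Pr N (1 + Mf + Mg) T (fun s w => f s w - g s w)
      (fun s w => (f s w - g s w) + (f s w ^ 2 - g s w ^ 2)) where
  mh := hf.meas.sub hg.meas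
  msk := (hf.meas.sub hg.meas).add (hf.sq_meas.sub hg.sq_meas)
  hb s w := by
    have := hf.bdd s w
    have := hg.bdd s w
    have := abs_sub (f s w) (g s w)
    linarith
  kb s w := by
    rw [show (f s w - g s w) + (f s w ^ 2 - g s w ^ 2) = (1 + f s w + g s w) * (f s w - g s w) by ring,
      abs_mul]
    refine mul_le_mul_of_nonneg_right ?_ (abs_nonneg _)
    have a := abs_le.1 (hf.bdd s w)
    have b := abs_le.1 (hg.bdd s w)
    rw [abs_le]; constructor <;> linarith
  int s := by
    refine ((hf.int s).add (hg.int s)).mono' ?_ (ae_of_all _ fun w => ?_)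
    · exact ((measurable_const.add measurable_norm).mul
        ((hf.meas1 s).sub (hg.meas1 s)).abs).aestronglyMeasurable
    · rw [Real.norm_of_nonneg (by positivity)]
      simp only [Pi.add_apply]
      rw [← mul_add]
      exact mul_le_mul_of_nonneg_left (abs_sub _ _) (by positivity)
  l1 s := by
    calc ∫ w, (1 + ‖w‖) * |f s w - g s w|
        ≤ ∫ w, ((1 + ‖w‖) * |f s w| + (1 + ‖w‖) * |g s w|) := by
          refine integral_mono_of_nonneg (ae_of_all _ fun w => by positivity)
            ((hf.int s).add (hg.int s)) (ae_of_all _ fun w => ?_)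
          simp only
          rw [← mul_add]
          exact mul_le_mul_of_nonneg_left (abs_sub _ _) (by positivity)
      _ = (∫ w, (1 + ‖w‖) * |f s w|) + ∫ w, (1 + ‖w‖) * |g s w| :=
          integral_add (hf.int s) (hg.int s)
      _ ≤ 1 + Mf + Mg := by linarith [hf.l1 s, hg.l1 s]
  ch s₀ := by
    have l : Tendsto (fun s => (∫ w, |f s w - f s₀ w|) + ∫ w, |g s w - g s₀ w|) (𝓝 s₀) (𝓝 0) := by
      simpa using (cf s₀).add (cg s₀)
    refine squeeze_zero (fun s => integral_nonneg fun w => abs_nonneg _) (fun s => ?_) l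
    have i1 := ((hf.integrable s).sub (hf.integrable s₀)).abs
    have i2 := ((hg.integrable s).sub (hg.integrable s₀)).abs
    simp only [Pi.sub_apply] at i1 i2
    rw [← integral_add i1 i2]
    refine integral_mono_of_nonneg (ae_of_all _ fun w => abs_nonneg _) (i1.add i2)
      (ae_of_all _ fun w => ?_)
    simp only
    rw [show f s w - g s w - (f s₀ w - g s₀ w) = (f s w - f s₀ w) - (g s w - g s₀ w) by ring]
    exact abs_sub _ _
  ck s₀ := by
    have l : Tendsto (fun s => (1 + 2 * Mf) * (∫ w, |f s w - f s₀ w|) +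
        (1 + 2 * Mg) * ∫ w, |g s w - g s₀ w|) (𝓝 s₀) (𝓝 0) := by
      simpa using ((cf s₀).const_mul (1 + 2 * Mf)).add ((cg s₀).const_mul (1 + 2 * Mg))
    refine squeeze_zero (fun s => integral_nonneg fun w => abs_nonneg _) (fun s => ?_) l
    have i1 := ((hf.integrable s).sub (hf.integrable s₀)).abs.const_mul (1 + 2 * Mf)
    have i2 := ((hg.integrable s).sub (hg.integrable s₀)).abs.const_mul (1 + 2 * Mg)
    simp only [Pi.sub_apply] at i1 i2
    rw [← integral_const_mul, ← integral_const_mul, ← integral_add i1 i2]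
    refine integral_mono_of_nonneg (ae_of_all _ fun w => abs_nonneg _) (i1.add i2)
      (ae_of_all _ fun w => ?_)
    simp only
    rw [show f s w - g s w + (f s w ^ 2 - g s w ^ 2) - (f s₀ w - g s₀ w + (f s₀ w ^ 2 - g s₀ w ^ 2))
      = (1 + f s w + f s₀ w) * (f s w - f s₀ w) - (1 + g s w + g s₀ w) * (g s w - g s₀ w) by ring]
    refine (abs_sub _ _).trans (add_le_add ?_ ?_)
    · rw [abs_mul]
      refine mul_le_mul_of_nonneg_right ?_ (abs_nonneg _)
      have a := abs_le.1 (hf.bdd s w)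
      have b := abs_le.1 (hf.bdd s₀ w)
      rw [abs_le]; constructor <;> linarith
    · rw [abs_mul]
      refine mul_le_mul_of_nonneg_right ?_ (abs_nonneg _)
      have a := abs_le.1 (hg.bdd s w)
      have b := abs_le.1 (hg.bdd s₀ w)
      rw [abs_le]; constructor <;> linarith
  wk ψ hψ t ht := by
    have sp : ∀ (s : ℝ) {q : Evec N → ℝ}, Tst q → ∫ w, (f s w - g s w) * q w =
        (∫ w, f s w * q w) - ∫ w, g s w * q w := fun s q hq => by
      rw [← integral_sub (hf.i_bdd s hq) (hg.i_bdd s hq)]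
      congr 1; ext w; ring
    have sq : ∀ (s : ℝ), ∫ w, (f s w - g s w + (f s w ^ 2 - g s w ^ 2)) * fderiv ℝ ψ w w =
        ((∫ w, f s w * fderiv ℝ ψ w w) + ∫ w, f s w ^ 2 * fderiv ℝ ψ w w) -
        ((∫ w, g s w * fderiv ℝ ψ w w) + ∫ w, g s w ^ 2 * fderiv ℝ ψ w w) := fun s => by
      have a1 := hf.i_bdd s hψ.euler
      have a2 := hf.sq.i_bdd s hψ.euler
      have b1 := hg.i_bdd s hψ.euler
      have b2 := hg.sq.i_bdd s hψ.euler
      rw [← integral_add a1 a2, ← integral_add b1 b2]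
      refine Eq.trans ?_ (integral_sub (a1.add a2) (b1.add b2))
      refine integral_congr_ae (ae_of_all _ fun w => ?_)
      simp only [Pi.add_apply]; ring
    rw [sp t hψ, sp 0 hψ, weak2 hf mf hψ ht, weak2 hg mg hψ ht]
    have jf := (hf.i_time t hψ.lap).sub ((hf.i_time t hψ.euler).add (hf.sq.i_time t hψ.euler))
    have jg := (hg.i_time t hψ.lap).sub ((hg.i_time t hψ.euler).add (hg.sq.i_time t hψ.euler))
    have e : ∫ s in Set.Ioc (0 : ℝ) t, ((∫ w, (f s w - g s w) * Lap ψ w) -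
        ∫ w, (f s w - g s w + (f s w ^ 2 - g s w ^ 2)) * fderiv ℝ ψ w w) =
      (∫ s in Set.Ioc (0 : ℝ) t,
      ((∫ w, f s w * Lap ψ w) - ((∫ w, f s w * fderiv ℝ ψ w w) +
        ∫ w, f s w ^ 2 * fderiv ℝ ψ w w))) - ∫ s in Set.Ioc (0 : ℝ) t,
      ((∫ w, g s w * Lap ψ w) - ((∫ w, g s w * fderiv ℝ ψ w w) +
        ∫ w, g s w ^ 2 * fderiv ℝ ψ w w)) := by
      refine Eq.trans ?_ (integral_sub jf jg)
      refine setIntegral_congr_fun measurableSet_Ioc fun s hs => ?_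
      show _ = ((∫ w, f s w * Lap ψ w) - ((∫ w, f s w * fderiv ℝ ψ w w) +
        ∫ w, f s w ^ 2 * fderiv ℝ ψ w w)) - ((∫ w, g s w * Lap ψ w) -
        ((∫ w, g s w * fderiv ℝ ψ w w) + ∫ w, g s w ^ 2 * fderiv ℝ ψ w w))
      beta_reduce
      rw [sp s hψ.lap, sq s]; ring
    rw [e]; ring

end

end

/-- **Comparison principle (Lemma 2.9, second part).** If `f, g ∈ X_T` solve the Cauchy problem
with respective initial data `f₀, g₀ ∈ Υ` and `f₀ ≤ g₀` a.e., then `f(t) ≤ g(t)` a.e.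
for every `0 < t ≤ T`. -/
theorem comparison_principle
    (N : ℕ) (hN : 1 ≤ N) (m p T : ℝ) (hm : 1 ≤ m) (hpN : (N : ℝ) < p) (hp2 : 2 ≤ p)
    (hT : 0 < T) (f₀ g₀ : Evec N → ℝ) (hf₀Ups : MemUpsilon N p m f₀)
    (hg₀Ups : MemUpsilon N p m g₀)
    (f g : ℝ → Evec N → ℝ) (hf : MemXT N p m T f₀ f) (hg : MemXT N p m T g₀ g)
    (hle : ∀ᵐ v : Evec N ∂volume, f₀ v ≤ g₀ v) :
    ∀ t ∈ Set.Ioc (0 : ℝ) T, ∀ᵐ v : Evec N ∂volume, f t v ≤ g t v := by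
  intro t ht
  obtain ⟨Mf, F, nf, mf, ef, cf⟩ := good hT hf.1
  obtain ⟨Mg, G, ng, mg, eg, cg⟩ := good hT hg.1
  have h0 : (0:ℝ) ∈ Set.Icc 0 T := ⟨le_rfl, hT.le⟩
  have ht' : t ∈ Set.Icc 0 T := ⟨ht.1.le, ht.2⟩
  have key := (mkPr nf ng mf mg cf cg).nonpos ht' (by
    filter_upwards [ef 0 h0, eg 0 h0, hf.1.2.2.1, hg.1.2.2.1, hle] with w a b c d e
    rw [a, b, c, d]; linarith)
  filter_upwards [key, ef t ht', eg t ht'] with w a b c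
  rw [b, c] at a; linarith
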